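/- arXiv:2507.11828 — 2 statements merged into one kernel-verified Lean document; each statement's English description precedes it below -/
import Mathlib

section
/- Let q be an odd prime and S a finite set of nonzero integers none of which is a perfect q-th power, with associated map π_q : S → F_q^n. Then for every F_q-linear map χ : F_q^n → F_q there exist infinitely many primes p such that p ≡ 1 (mod q), p divides no element of S, and there exists a surjective group homomorphism φ from the unit group (ℤ/pℤ)ˣ to the additive group ℤ/qℤ satisfying φ(s mod p) = χ(π_q(s)) for every s ∈ S. -/
open Finset

/-- `S ∈ 𝒯_{k,q}`: there is a positive integer `Δ` such that for every natural number `N`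
with `Ω(N) ≤ k` and `gcd(N, Δ) = 1`, some `s ∈ S` is a `q`-th power modulo `N`. -/
def MemT (q k : ℕ) (S : Set ℤ) : Prop :=
  ∃ Δ : ℕ, 0 < Δ ∧ ∀ N : ℕ, 0 < N → N.primeFactorsList.length ≤ k → Nat.Coprime N Δ →
    ∃ s ∈ S, ∃ x : ℤ, (N : ℤ) ∣ x ^ q - s

/-- `s` is a perfect `q`-th power of an integer. -/
def IsPerfectPow (q : ℕ) (s : ℤ) : Prop := ∃ r : ℤ, r ^ q = s

/-- The finite set of primes dividing `∏_{s ∈ S} rad_q(|s|)`, i.e. the primes `p` such that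
`q ∤ v_p(|s|)` for some `s ∈ S`. -/
def qPrimes (q : ℕ) (S : Finset ℤ) : Finset ℕ :=
  S.sup fun s => s.natAbs.primeFactors.filter fun p => ¬ q ∣ s.natAbs.factorization p

/-- The vector `(v_{p_1}(|u|) mod q, …, v_{p_n}(|u|) mod q)` where `p_1 < … < p_n`
is the increasing enumeration of the finite set of primes `P`. -/
def vecOf (q : ℕ) (P : Finset ℕ) (u : ℤ) : Fin P.card → ZMod q :=
  fun i => ((u.natAbs.factorization (P.orderIsoOfFin rfl i).1 : ℕ) : ZMod q)

/-- The projective point `⟨v⟩` of `PG(F_q^n)` spanned by a vector `v`. -/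
def projPoint {q n : ℕ} (v : Fin n → ZMod q) : Submodule (ZMod q) (Fin n → ZMod q) :=
  Submodule.span (ZMod q) {v}

/-- The set of projective points associated with `S` in `PG(F_q^n)`,
`n` being the number of distinct primes dividing `∏_{s ∈ S} rad_q(|s|)`. -/
def assocPoints (q : ℕ) (S : Finset ℤ) :
    Set (Submodule (ZMod q) (Fin (qPrimes q S).card → ZMod q)) :=
  {P | ∃ s ∈ S, P = projPoint (vecOf q (qPrimes q S) s)}

/-- `B` is a `k`-blocking set of `PG(F_q^n)`: every subspace of codimension `k`
contains a nonzero vector spanning a point of `B`. -/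
def IsBlockingSet (q n k : ℕ) (B : Set (Submodule (ZMod q) (Fin n → ZMod q))) : Prop :=
  ∀ W : Submodule (ZMod q) (Fin n → ZMod q), Module.finrank (ZMod q) W = n - k →
    ∃ v ∈ W, v ≠ 0 ∧ projPoint v ∈ B

/-- `B` is (the point set of) a `k`-space of `PG(F_q^n)`. -/
def IsKSpace (q n k : ℕ) (B : Set (Submodule (ZMod q) (Fin n → ZMod q))) : Prop :=
  ∃ W : Submodule (ZMod q) (Fin n → ZMod q), Module.finrank (ZMod q) W = k + 1 ∧
    B = {P | ∃ v ∈ W, v ≠ 0 ∧ P = projPoint v}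

/-- `S` and `T` are geometrically `q`-equivalent: some element of `PGL(n, q)` maps the point set
associated with `S` onto the point set associated with `T`, where the points are computed with
respect to all the primes dividing `(∏_{s ∈ S} rad_q(|s|)) ⬝ (∏_{t ∈ T} rad_q(|t|))`. -/
def GeomEquiv (q : ℕ) (S T : Finset ℤ) : Prop :=
  ∃ Ψ : (Fin (qPrimes q (S ∪ T)).card → ZMod q) ≃ₗ[ZMod q]
        (Fin (qPrimes q (S ∪ T)).card → ZMod q),
    (Submodule.map Ψ.toLinearMap) ''
        {P | ∃ s ∈ S, P = projPoint (vecOf q (qPrimes q (S ∪ T)) s)} =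
      {P | ∃ t ∈ T, P = projPoint (vecOf q (qPrimes q (S ∪ T)) t)}

/-- The set of squares of `F_qˣ` together with `0`. -/
def Q0 (q : ℕ) : Set (ZMod q) := {x | (∃ a : ZMod q, a ≠ 0 ∧ a ^ 2 = x) ∨ x = 0}

namespace CharLemma
section one
open NumberField Ideal Filter Topology
variable {K : Type*} [Field K] [NumberField K]

/-- number of ideals of norm `n` -/
noncomputable def rr (K : Type*) [Field K] [NumberField K] (n : ℕ) : ℕ :=
  Nat.card {I : Ideal (𝓞 K) // absNorm I = n}

lemma rr_one : rr K 1 = 1 := by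
  unfold rr
  simp [Ideal.absNorm_eq_one_iff]

lemma sup_span_eq_top_of_coprime {m n : ℕ} (h : Nat.Coprime m n) :
    Ideal.span {(m : 𝓞 K)} ⊔ Ideal.span {(n : 𝓞 K)} = ⊤ := by
  rw [← Ideal.isCoprime_iff_sup_eq, Ideal.isCoprime_span_singleton_iff]
  exact Nat.Coprime.cast h

lemma absNorm_mem_aux (I : Ideal (𝓞 K)) {m : ℕ} (h : absNorm I = m) :
    Ideal.span {(m : 𝓞 K)} ≤ I := by
  rw [Ideal.span_singleton_le_iff_mem, ← h]
  exact Ideal.absNorm_mem I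

lemma recover {m n : ℕ} (h : Nat.Coprime m n) (I J : Ideal (𝓞 K)) (hI : absNorm I = m)
    (hJ : absNorm J = n) : I = I * J ⊔ Ideal.span {(m : 𝓞 K)} := by
  have h1 := absNorm_mem_aux I hI
  have h2 := absNorm_mem_aux J hJ
  apply le_antisymm
  · have h3 : J ⊔ Ideal.span {(m : 𝓞 K)} = ⊤ := by
      rw [eq_top_iff, ← sup_span_eq_top_of_coprime h]
      exact sup_le le_sup_right (h2.trans le_sup_left)
    calc I = I * (J ⊔ Ideal.span {(m : 𝓞 K)}) := by rw [h3, Ideal.mul_top]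
      _ = I * J ⊔ I * Ideal.span {(m : 𝓞 K)} := Ideal.mul_sup _ _ _
      _ ≤ _ := sup_le_sup_left Ideal.mul_le_right _
  · exact sup_le Ideal.mul_le_left h1

lemma norm_coprime_of_le {m : ℕ} {n : ℕ} (h : Nat.Coprime m n) (I : Ideal (𝓞 K))
    (hI : Ideal.span {(m : 𝓞 K)} ≤ I) : Nat.Coprime (absNorm I) n := by
  have : absNorm I ∣ absNorm (Ideal.span {(m : 𝓞 K)}) := Ideal.absNorm_dvd_absNorm_of_le hI
  refine Nat.Coprime.coprime_dvd_left this ?_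
  rw [Ideal.absNorm_span_singleton]
  have : Algebra.norm ℤ ((m : 𝓞 K)) = (m : ℤ) ^ Module.finrank ℤ (𝓞 K) := by
    have := Algebra.norm_algebraMap (S := 𝓞 K) (m : ℤ)
    simpa using this
  rw [this, Int.natAbs_pow, Int.natAbs_natCast]
  exact Nat.Coprime.pow_left _ h

lemma rr_mul {m n : ℕ} (h : Nat.Coprime m n) : rr K (m * n) = rr K m * rr K n := by
  unfold rr
  rw [← Nat.card_prod]
  symm
  refine Nat.card_eq_of_bijective
    (fun x : {I : Ideal (𝓞 K) // absNorm I = m} × {I : Ideal (𝓞 K) // absNorm I = n} =>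
      (⟨x.1.1 * x.2.1, by rw [map_mul, x.1.2, x.2.2]⟩ :
        {I : Ideal (𝓞 K) // absNorm I = m * n})) ⟨?_, ?_⟩
  · rintro ⟨⟨I, hI⟩, ⟨J, hJ⟩⟩ ⟨⟨I', hI'⟩, ⟨J', hJ'⟩⟩ hh
    simp only [Subtype.mk.injEq] at hh
    have e1 : I = I' := by rw [recover h I J hI hJ, hh, ← recover h I' J' hI' hJ']
    have e2 : J = J' := by
      rw [recover h.symm J I hJ hI, mul_comm, hh, mul_comm, ← recover h.symm J' I' hJ' hI']
    simp [e1, e2]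
  · rintro ⟨A, hA⟩
    have hmn : Ideal.span {(m : 𝓞 K)} * Ideal.span {(n : 𝓞 K)} ≤ A := by
      rw [Ideal.span_singleton_mul_span_singleton, Ideal.span_singleton_le_iff_mem,
        ← Nat.cast_mul, ← hA]
      exact Ideal.absNorm_mem A
    set I := A ⊔ Ideal.span {(m : 𝓞 K)} with hI
    set J := A ⊔ Ideal.span {(n : 𝓞 K)} with hJ
    have hIJ : I * J = A := by
      apply le_antisymm
      · rw [hI, hJ, Ideal.sup_mul, Ideal.mul_sup, Ideal.mul_sup]
        exact sup_le (sup_le Ideal.mul_le_left Ideal.mul_le_left)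
          (sup_le Ideal.mul_le_right hmn)
      · calc A = A * (Ideal.span {(n : 𝓞 K)} ⊔ Ideal.span {(m : 𝓞 K)}) := by
              rw [sup_span_eq_top_of_coprime h.symm, Ideal.mul_top]
          _ ≤ I * J := by
              rw [Ideal.mul_sup]
              refine sup_le (Ideal.mul_mono le_sup_left le_sup_right) ?_
              rw [mul_comm]
              exact Ideal.mul_mono le_sup_right le_sup_left
    have hN : absNorm I * absNorm J = m * n := by rw [← map_mul, hIJ, hA]
    have c1 : Nat.Coprime (absNorm I) n := norm_coprime_of_le h I le_sup_right
    have c2 : Nat.Coprime (absNorm J) m := norm_coprime_of_le h.symm J le_sup_right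
    have d1 : absNorm I ∣ m := c1.dvd_of_dvd_mul_right (hN ▸ Dvd.intro _ rfl)
    have d2 : m ∣ absNorm I := c2.symm.dvd_of_dvd_mul_right (hN ▸ Dvd.intro _ rfl)
    have d3 : absNorm J ∣ n := c2.dvd_of_dvd_mul_left (hN ▸ Dvd.intro_left _ rfl)
    have d4 : n ∣ absNorm J := c1.symm.dvd_of_dvd_mul_left (hN ▸ Dvd.intro_left _ rfl)
    refine ⟨(⟨I, Nat.dvd_antisymm d1 d2⟩, ⟨J, Nat.dvd_antisymm d3 d4⟩), ?_⟩
    simpa using hIJ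


end one
section two
open NumberField Ideal Filter Topology UniqueFactorizationMonoid

variable {K : Type*} [Field K] [NumberField K]

lemma liesOver_of_mem {p : ℕ} (hp : p.Prime) (P : Ideal (𝓞 K)) (hP : P.IsPrime)
    (h : (p : 𝓞 K) ∈ P) : P.LiesOver (Ideal.span {(p : ℤ)}) := by
  haveI := Fact.mk hp
  constructor
  have hm : (Ideal.span {(p : ℤ)}).IsMaximal := Int.ideal_span_isMaximal_of_prime p
  refine hm.eq_of_le ?_ ?_
  · exact (Ideal.IsPrime.under ℤ P).ne_top
  · rw [Ideal.span_singleton_le_iff_mem, Ideal.mem_comap]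
    simpa using h

lemma mem_of_dvd_norm {p e : ℕ} (hp : p.Prime) (I : Ideal (𝓞 K)) (hI : absNorm I = p ^ e)
    (P : Ideal (𝓞 K)) (hP : P.IsPrime) (hd : P ∣ I) : (p : 𝓞 K) ∈ P := by
  have h1 : (absNorm I : 𝓞 K) ∈ P := Ideal.le_of_dvd hd (Ideal.absNorm_mem I)
  rw [hI, Nat.cast_pow] at h1
  exact hP.mem_of_pow_mem e h1

lemma rr_pow_le {p : ℕ} (hp : p.Prime) (e : ℕ) :
    rr K (p ^ e) ≤ (e + 1) ^ Module.finrank ℚ K := by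
  classical
  haveI := Fact.mk hp
  have hm : (Ideal.span {(p : ℤ)}).IsMaximal := Int.ideal_span_isMaximal_of_prime p
  have hb : Ideal.span {(p : ℤ)} ≠ ⊥ := by simp [hp.ne_zero]
  set T := IsDedekindDomain.primesOverFinset (Ideal.span {(p : ℤ)}) (𝓞 K) with hT
  have hTc : T.card ≤ Module.finrank ℚ K :=
    Ideal.card_primesOverFinset_le_finrank (𝓞 K) ℚ K hb
  have key : ∀ I : Ideal (𝓞 K), absNorm I = p ^ e → ∀ P ∈ normalizedFactors I, P ∈ T := by
    intro I hI P hP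
    have hI0 : I ≠ 0 := by
      rintro rfl
      have := pow_pos hp.pos e
      simp at hI
      omega
    have hPp := (prime_of_normalized_factor P hP)
    have hPP := Ideal.isPrime_of_prime hPp
    rw [hT, IsDedekindDomain.mem_primesOverFinset_iff hb]
    exact ⟨hPP, liesOver_of_mem hp P hPP
      (mem_of_dvd_norm hp I hI P hPP (dvd_of_mem_normalizedFactors hP))⟩
  have hcount : ∀ I : Ideal (𝓞 K), absNorm I = p ^ e → ∀ P : Ideal (𝓞 K), P ∈ T →
      (normalizedFactors I).count P < e + 1 := by
    intro I hI P hP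
    have hI0 : I ≠ 0 := by
      rintro rfl
      have := pow_pos hp.pos e
      simp at hI
      omega
    rw [hT, IsDedekindDomain.mem_primesOverFinset_iff hb] at hP
    obtain ⟨hPP, hPL⟩ := hP
    have hd : P ^ (normalizedFactors I).count P ∣ I := by
      have h2 : Multiset.replicate ((normalizedFactors I).count P) P ≤ normalizedFactors I :=
        Multiset.le_count_iff_replicate_le.mp le_rfl
      have := Multiset.prod_dvd_prod_of_le h2
      rwa [Multiset.prod_replicate, Ideal.prod_normalizedFactors_eq_self hI0] at this
    have hd2 := map_dvd (absNorm (S := 𝓞 K)) hd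
    rw [map_pow, hI, Ideal.absNorm_eq_pow_inertiaDeg' P hp, ← pow_mul,
      Nat.pow_dvd_pow_iff_le_right hp.one_lt] at hd2
    have h3 : 0 < (Ideal.span {(p : ℤ)}).inertiaDeg' P := Nat.pos_of_ne_zero (Ideal.inertiaDeg'_ne_zero _ P)
    nlinarith
  let F : {I : Ideal (𝓞 K) // absNorm I = p ^ e} → (T → Fin (e + 1)) :=
    fun I P => ⟨(normalizedFactors I.1).count P.1, hcount I.1 I.2 P.1 P.2⟩
  have hF : Function.Injective F := by
    rintro ⟨I, hI⟩ ⟨J, hJ⟩ h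
    have h0 : ∀ I : Ideal (𝓞 K), absNorm I = p ^ e → I ≠ ⊥ := by
      rintro I hI rfl
      have := pow_pos hp.pos e
      simp at hI
      omega
    have : normalizedFactors I = normalizedFactors J := by
      ext P
      by_cases hP : P ∈ T
      · have := congrFun h ⟨P, hP⟩
        simpa [F] using this
      · rw [Multiset.count_eq_zero_of_notMem fun h => hP (key I hI P h),
          Multiset.count_eq_zero_of_notMem fun h => hP (key J hJ P h)]
    simp only [Subtype.mk.injEq]
    rw [← Ideal.prod_normalizedFactors_eq_self (h0 I hI), this,
      Ideal.prod_normalizedFactors_eq_self (h0 J hJ)]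
  calc rr K (p ^ e) ≤ Nat.card (T → Fin (e + 1)) := Nat.card_le_card_of_injective F hF
    _ = (e + 1) ^ T.card := by simp
    _ ≤ _ := Nat.pow_le_pow_right (by omega) hTc

open Polynomial RingOfIntegers

/-- number of roots of `f` mod `p` -/
noncomputable def nroots (f : ℤ[X]) (p : ℕ) : ℕ :=
  Nat.card {x : ZMod p // (f.map (Int.castRingHom (ZMod p))).eval x = 0}

lemma rr_prime {θ : 𝓞 K} {p : ℕ} (hp : p.Prime) (hpe : ¬ p ∣ exponent θ) :
    rr K p = nroots (minpoly ℤ θ) p := by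
  classical
  haveI := Fact.mk hp
  have hm : (Ideal.span {(p : ℤ)}).IsMaximal := Int.ideal_span_isMaximal_of_prime p
  set f := (minpoly ℤ θ).map (Int.castRingHom (ZMod p)) with hf
  have hf0 : f ≠ 0 := map_monic_ne_zero (minpoly.monic θ.isIntegral)
  have hmem : ∀ x : ZMod p, f.eval x = 0 → (X - C x) ∈ monicFactorsMod θ p := by
    intro x hx
    rw [Multiset.mem_toFinset, Polynomial.mem_normalizedFactors_iff hf0]
    exact ⟨irreducible_X_sub_C x, monic_X_sub_C x, dvd_iff_isRoot.mpr hx⟩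
  have hdeg : ∀ Q (hQ : Q ∈ monicFactorsMod θ p),
      absNorm ((NumberField.Ideal.primesOverSpanEquivMonicFactorsMod hpe).symm ⟨Q, hQ⟩ : Ideal (𝓞 K))
        = p ^ natDegree Q := by
    intro Q hQ
    set P := (NumberField.Ideal.primesOverSpanEquivMonicFactorsMod hpe).symm ⟨Q, hQ⟩ with hP
    haveI : (P : Ideal (𝓞 K)).LiesOver (Ideal.span {(p : ℤ)}) := P.2.2
    haveI : (P : Ideal (𝓞 K)).IsMaximal := Ideal.primesOver.isMaximal P
    rw [Ideal.absNorm_eq_pow_inertiaDeg' _ hp, Ideal.inertiaDeg'_eq_inertiaDeg, hP,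
      NumberField.Ideal.inertiaDeg_primesOverSpanEquivMonicFactorsMod_symm_apply']
  unfold rr nroots
  symm
  refine Nat.card_eq_of_bijective
    (fun x : {x : ZMod p // f.eval x = 0} =>
      (⟨((NumberField.Ideal.primesOverSpanEquivMonicFactorsMod hpe).symm
          ⟨X - C x.1, hmem x.1 x.2⟩ : Ideal (𝓞 K)), by rw [hdeg]; simp⟩ :
        {I : Ideal (𝓞 K) // absNorm I = p})) ⟨?_, ?_⟩
  · rintro ⟨x, hx⟩ ⟨y, hy⟩ h
    simp only [Subtype.mk.injEq] at h
    have h2 := (NumberField.Ideal.primesOverSpanEquivMonicFactorsMod hpe).symm.injective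
      (Subtype.ext h)
    simpa using h2
  · rintro ⟨I, hI⟩
    have hIp : I.IsPrime := Ideal.isPrime_of_irreducible_absNorm (by rw [hI]; exact hp)
    have hmemI : (p : 𝓞 K) ∈ I := by
      have := Ideal.absNorm_mem I
      rwa [hI] at this
    have hL := liesOver_of_mem hp I hIp hmemI
    set Q := NumberField.Ideal.primesOverSpanEquivMonicFactorsMod hpe ⟨I, hIp, hL⟩ with hQ
    have hQ' : (NumberField.Ideal.primesOverSpanEquivMonicFactorsMod hpe).symm Q = ⟨I, hIp, hL⟩ := by
      rw [hQ, Equiv.symm_apply_apply]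
    have h1 := hdeg Q.1 Q.2
    rw [Subtype.coe_eta, hQ', hI] at h1
    have h2 : natDegree Q.1 = 1 := by
      have := Nat.pow_right_injective hp.two_le ((pow_one p).trans h1)
      exact this.symm
    have h3 := Q.2
    rw [Multiset.mem_toFinset, Polynomial.mem_normalizedFactors_iff hf0] at h3
    obtain ⟨_, hmon, hdvd⟩ := h3
    have h4 : Q.1 = X - C (- Q.1.coeff 0) := by
      conv_lhs => rw [hmon.eq_X_add_C h2]
      simp
    have h5 : f.eval (- Q.1.coeff 0) = 0 := by
      rw [h4] at hdvd
      have := dvd_iff_isRoot.mp hdvd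
      simpa using this
    refine ⟨⟨_, h5⟩, ?_⟩
    simp only [Subtype.mk.injEq]
    have h6 : (⟨X - C (- Q.1.coeff 0), hmem _ h5⟩ : {x // x ∈ monicFactorsMod θ p}) = Q :=
      Subtype.ext h4.symm
    rw [h6, hQ']

lemma exponent_ne_zero {θ : 𝓞 K} (hθ : Algebra.adjoin ℚ {(θ : K)} = ⊤) : exponent θ ≠ 0 := by
  have hint : IsIntegral ℚ (θ : K) := (θ.isIntegral_coe).tower_top
  let B := PowerBasis.ofAdjoinEqTop hint hθ
  have hB : B.gen = (θ : K) := PowerBasis.ofAdjoinEqTop_gen hint hθ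
  have hBi : IsIntegral ℤ B.gen := by rw [hB]; exact θ.isIntegral_coe
  obtain ⟨d, hd⟩ : ∃ d : ℤ, (d : ℚ) = Algebra.discr ℚ B.basis := by
    have := Algebra.discr_isIntegral ℚ (R := ℤ) (b := B.basis) (fun i => by
      rw [B.basis_eq_pow]; exact hBi.pow _)
    exact (IsIntegrallyClosed.isIntegral_iff).mp this
  have hd0 : d ≠ 0 := by
    rintro rfl
    exact Algebra.discr_not_zero_of_basis ℚ B.basis (by rw [← hd]; simp)
  have hcond : (d : 𝓞 K) ∈ conductor ℤ θ := by
    intro b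
    have h := Algebra.discr_mul_isIntegral_mem_adjoin ℚ hBi (b.isIntegral_coe)
    rw [← hd, hB] at h
    have h2 : (((d : 𝓞 K) * b : 𝓞 K) : K) ∈ Algebra.adjoin ℤ {(θ : K)} := by
      convert h using 1
      simp [Algebra.smul_def]
    have h3 : Algebra.adjoin ℤ {(θ : K)} =
        (Algebra.adjoin ℤ {θ}).map (IsScalarTower.toAlgHom ℤ (𝓞 K) K) := by
      rw [AlgHom.map_adjoin]; simp
    rw [h3] at h2
    obtain ⟨y, hy, hy2⟩ := h2
    have : y = (d : 𝓞 K) * b := RingOfIntegers.ext (by simpa using hy2)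
    rw [← this]; exact hy
  unfold exponent
  intro h0
  rw [Ideal.absNorm_eq_zero_iff] at h0
  have : d ∈ under ℤ (conductor ℤ θ) := by
    rw [Ideal.mem_comap]; simpa using hcond
  rw [h0] at this
  exact hd0 (by simpa using this)

end two
section three
open NumberField Ideal Filter Topology UniqueFactorizationMonoid
open Polynomial RingOfIntegers

lemma log_one_add_bounds {x y M : ℝ} (hx : 0 ≤ x) (h1 : 1 + x ≤ y) (h2 : y ≤ 1 + x + M) :
    x - x ^ 2 ≤ Real.log y ∧ Real.log y ≤ x + M := by
  have hy : 0 < y := by linarith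
  constructor
  · have h3 : 1 - (1 + x)⁻¹ ≤ Real.log (1 + x) := Real.one_sub_inv_le_log_of_pos (by linarith)
    have h4 : Real.log (1 + x) ≤ Real.log y := Real.log_le_log (by linarith) h1
    have h5 : x - x ^ 2 ≤ 1 - (1 + x)⁻¹ := by
      have h6 : 0 < 1 + x := by linarith
      have : 1 - (1 + x)⁻¹ - (x - x ^ 2) = x ^ 3 / (1 + x) := by field_simp; ring
      have : 0 ≤ x ^ 3 / (1 + x) := by positivity
      linarith
    linarith
  · have := Real.log_le_sub_one_of_pos hy
    linarith

lemma summable_tailConst (d : ℕ) : Summable fun e : ℕ => ((e : ℝ) + 3) ^ d * (1 / 2 : ℝ) ^ e := by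
  have h := summable_pow_mul_geometric_of_norm_lt_one (R := ℝ) d (r := 1 / 2) (by norm_num)
  have h2 := ((summable_nat_add_iff 3).mpr h).mul_left 8
  refine h2.congr fun e => ?_
  push_cast
  rw [pow_add (1 / 2 : ℝ)]
  norm_num
  ring

lemma euler_log (r : ℕ → ℕ) (d : ℕ) (hr1 : r 1 = 1)
    (hmul : ∀ {m n : ℕ}, Nat.Coprime m n → r (m * n) = r m * r n)
    (hbd : ∀ {p : ℕ}, p.Prime → ∀ e, r (p ^ e) ≤ (e + 1) ^ d) :
    ∃ C : ℝ, ∀ s : ℝ, 1 < s → Summable (fun n : ℕ => (r n : ℝ) * (n : ℝ) ^ (-s)) →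
      |Real.log (∑' n : ℕ, (r n : ℝ) * (n : ℝ) ^ (-s)) -
        ∑' p : Nat.Primes, (r p : ℝ) * (p : ℝ) ^ (-s)| ≤ C := by
  set M : ℝ := ∑' e : ℕ, ((e : ℝ) + 3) ^ d * (1 / 2 : ℝ) ^ e with hM
  have hM0 : 0 ≤ M := tsum_nonneg fun e => by positivity
  have hsq : Summable fun p : Nat.Primes => (M + 4 ^ d) * ((p : ℕ) : ℝ) ^ (-2 : ℝ) :=
    (Nat.Primes.summable_rpow.mpr (by norm_num)).mul_left _
  refine ⟨∑' p : Nat.Primes, (M + 4 ^ d) * ((p : ℕ) : ℝ) ^ (-2 : ℝ), fun s hs hsum => ?_⟩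
  set f : ℕ → ℝ := fun n => (r n : ℝ) * (n : ℝ) ^ (-s) with hf
  have hf0 : f 0 = 0 := by
    simp only [hf, Nat.cast_zero]
    rw [Real.zero_rpow (by linarith), mul_zero]
  have hf1 : f 1 = 1 := by simp [hf, hr1]
  have hfm : ∀ {m n : ℕ}, Nat.Coprime m n → f (m * n) = f m * f n := by
    intro m n h
    simp only [hf]
    rw [hmul h, Nat.cast_mul, Nat.cast_mul,
      Real.mul_rpow (Nat.cast_nonneg _) (Nat.cast_nonneg _)]
    ring
  have hfnn : ∀ n, 0 ≤ f n := fun n => by positivity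
  have hsn : Summable (‖f ·‖) := hsum.congr fun n => by
    rw [Real.norm_of_nonneg (hfnn n)]
  have hprod := EulerProduct.eulerProduct_hasProd hf1 hfm hsn hf0
  set E : Nat.Primes → ℝ := fun p => ∑' e, f ((p : ℕ) ^ e) with hE
  have hbounds : ∀ p : Nat.Primes, |Real.log (E p) - f p| ≤ (M + 4 ^ d) * ((p : ℕ) : ℝ) ^ (-2 : ℝ) ∧ 0 < E p := by
    intro p
    have hp := p.2
    have hp0 : (0 : ℝ) < (p : ℕ) := by exact_mod_cast hp.pos
    have hp1 : (1 : ℝ) ≤ (p : ℕ) := by exact_mod_cast hp.one_lt.le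
    have hp2 : (2 : ℝ) ≤ (p : ℕ) := by exact_mod_cast hp.two_le
    set x : ℝ := ((p : ℕ) : ℝ) ^ (-s) with hx
    have hx0 : 0 < x := Real.rpow_pos_of_pos hp0 _
    have hxp : x ≤ ((p : ℕ) : ℝ)⁻¹ := by
      rw [hx, ← Real.rpow_neg_one]
      exact Real.rpow_le_rpow_of_exponent_le hp1 (by linarith)
    have hx2 : x ≤ 1 / 2 := hxp.trans (by
      rw [one_div]; exact inv_anti₀ (by norm_num) hp2)
    have hxsq : x ^ 2 ≤ ((p : ℕ) : ℝ) ^ (-2 : ℝ) := by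
      rw [Real.rpow_neg hp0.le, Real.rpow_two, ← inv_pow]
      exact pow_le_pow_left₀ hx0.le hxp 2
    have hfp : ∀ e, f ((p : ℕ) ^ e) = (r ((p : ℕ) ^ e) : ℝ) * x ^ e := by
      intro e
      simp only [hf, hx]
      rw [Nat.cast_pow, ← Real.rpow_natCast, ← Real.rpow_natCast, ← Real.rpow_mul hp0.le,
        ← Real.rpow_mul hp0.le, mul_comm (e : ℝ)]
    have hsp : Summable fun e => f ((p : ℕ) ^ e) :=
      hsum.comp_injective (Nat.pow_right_injective hp.two_le)
    have hsplit : E p = 1 + f p + ∑' e, f ((p : ℕ) ^ (e + 2)) := by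
      have := hsp.sum_add_tsum_nat_add 2
      simp only [hE]
      rw [← this, Finset.sum_range_succ, Finset.sum_range_one, pow_zero, pow_one, hf1]
    have hterm : ∀ e : ℕ, f ((p : ℕ) ^ (e + 2)) ≤ (((e : ℝ) + 3) ^ d * (1 / 2 : ℝ) ^ e) * x ^ 2 := by
      intro e
      rw [hfp, pow_add x, ← mul_assoc]
      have h1 : (r ((p : ℕ) ^ (e + 2)) : ℝ) ≤ ((e : ℝ) + 3) ^ d := by
        have := hbd hp (e + 2)
        calc (r ((p : ℕ) ^ (e + 2)) : ℝ) ≤ (((e + 2 + 1) ^ d : ℕ) : ℝ) := by exact_mod_cast this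
          _ = _ := by push_cast; ring
      gcongr
    have htail : ∑' e, f ((p : ℕ) ^ (e + 2)) ≤ M * x ^ 2 := by
      rw [hM, ← tsum_mul_right]
      exact Summable.tsum_le_tsum hterm ((summable_nat_add_iff 2).mpr hsp)
        ((summable_tailConst d).mul_right _)
    have htail0 : 0 ≤ ∑' e, f ((p : ℕ) ^ (e + 2)) := tsum_nonneg fun e => hfnn _
    have hb := log_one_add_bounds (x := f p) (y := E p) (M := M * x ^ 2) (hfnn _)
      (by rw [hsplit]; linarith) (by rw [hsplit]; linarith)
    have hfp2 : (f p) ^ 2 ≤ 4 ^ d * x ^ 2 := by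
      have h1 : f p = (r p : ℝ) * x := by simpa using hfp 1
      have h2 : (r p : ℝ) ≤ 2 ^ d := by
        have := hbd hp 1
        rw [pow_one] at this
        exact_mod_cast this
      rw [h1, mul_pow]
      have h3 : (r p : ℝ) ^ 2 ≤ 4 ^ d := by
        calc (r p : ℝ) ^ 2 ≤ (2 ^ d) ^ 2 := by gcongr
          _ = 4 ^ d := by rw [← pow_mul, mul_comm, pow_mul]; norm_num
      gcongr
    have h4d : (0 : ℝ) ≤ 4 ^ d := by positivity
    refine ⟨?_, by rw [hsplit]; linarith [hfnn p]⟩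
    have hxx : 0 ≤ x ^ 2 := by positivity
    have : (M + 4 ^ d) * x ^ 2 ≤ (M + 4 ^ d) * ((p : ℕ) : ℝ) ^ (-2 : ℝ) := by gcongr
    rw [abs_le]
    constructor <;> nlinarith [hb.1, hb.2, mul_nonneg hM0 hxx, mul_nonneg h4d hxx]
  have hdiff : Summable fun p : Nat.Primes => Real.log (E p) - f p :=
    Summable.of_norm_bounded (f := fun p : Nat.Primes => Real.log (E p) - f p) hsq
      (fun p => by rw [Real.norm_eq_abs]; exact (hbounds p).1)
  have hfs : Summable fun p : Nat.Primes => f p := hsum.comp_injective Subtype.val_injective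
  have hlog : Summable fun p : Nat.Primes => Real.log (E p) := by
    have := hdiff.add hfs
    simpa using this
  have hexp := hlog.hasSum.rexp
  have hEe : (Real.exp ∘ fun p : Nat.Primes => Real.log (E p)) = E := by
    funext p
    simp [Real.exp_log (hbounds p).2]
  rw [hEe] at hexp
  have hZ : ∑' n, f n = Real.exp (∑' p, Real.log (E p)) := hprod.unique hexp
  rw [hZ, Real.log_exp, ← hlog.tsum_sub hfs]
  have := tsum_of_norm_bounded (f := fun p : Nat.Primes => Real.log (E p) - f p) hsq.hasSum
    (fun p => by rw [Real.norm_eq_abs]; exact (hbounds p).1)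
  rw [Real.norm_eq_abs] at this
  exact this

lemma zeta_bound (K : Type*) [Field K] [NumberField K] :
    ∃ C : ℝ, ∀ᶠ s : ℝ in 𝓝[>] 1,
      Summable (fun p : Nat.Primes => (rr K p : ℝ) * (p : ℝ) ^ (-s)) ∧
      |∑' p : Nat.Primes, (rr K p : ℝ) * (p : ℝ) ^ (-s) + Real.log (s - 1)| ≤ C := by
  obtain ⟨C, hC⟩ := euler_log (rr K) (Module.finrank ℚ K) rr_one rr_mul rr_pow_le
  have hlim := tendsto_sub_one_mul_dedekindZeta_nhdsGT K
  set ρ := dedekindZeta_residue K with hρ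
  have hρ0 : 0 < ρ := dedekindZeta_residue_pos K
  have hterm : ∀ s : ℝ, 1 < s → ∀ n : ℕ,
      LSeries.term (fun n ↦ (Nat.card {I : Ideal (𝓞 K) // absNorm I = n} : ℂ)) (s : ℂ) n =
        (((rr K n : ℝ) * (n : ℝ) ^ (-s) : ℝ) : ℂ) := by
    intro s hs n
    rw [LSeries.term_def]
    split_ifs with h
    · subst h
      rw [Nat.cast_zero, Real.zero_rpow (by linarith)]
      simp
    · rw [Complex.ofReal_mul, Complex.ofReal_cpow (Nat.cast_nonneg _), Complex.ofReal_neg,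
        Complex.cpow_neg, div_eq_mul_inv]
      simp [rr]
  have hz : ∀ s : ℝ, 1 < s → dedekindZeta K s =
      ((∑' n : ℕ, (rr K n : ℝ) * (n : ℝ) ^ (-s) : ℝ) : ℂ) := by
    intro s hs
    rw [dedekindZeta, LSeries, Complex.ofReal_tsum]
    exact tsum_congr (hterm s hs)
  have hlimR : Tendsto (fun s : ℝ => (s - 1) * ∑' n : ℕ, (rr K n : ℝ) * (n : ℝ) ^ (-s))
      (𝓝[>] 1) (𝓝 ρ) := by
    rw [← tendsto_ofReal_iff]
    refine hlim.congr' ?_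
    filter_upwards [self_mem_nhdsWithin] with s hs
    rw [hz s hs]
    push_cast
    rfl
  refine ⟨C + (|Real.log ρ| + 1), ?_⟩
  have hloglim := (Real.continuousAt_log hρ0.ne').tendsto.comp hlimR
  have hev := (Metric.tendsto_nhds.mp hloglim) 1 one_pos
  filter_upwards [self_mem_nhdsWithin, hev, hlimR.eventually (lt_mem_nhds hρ0)] with s hs h1 h2
  have hs1 : (0 : ℝ) < s - 1 := sub_pos.mpr hs
  have hZ : 0 < ∑' n : ℕ, (rr K n : ℝ) * (n : ℝ) ^ (-s) := by
    by_contra hneg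
    push Not at hneg
    nlinarith
  have hsum : Summable (fun n : ℕ => (rr K n : ℝ) * (n : ℝ) ^ (-s)) := by
    by_contra hns
    rw [tsum_eq_zero_of_not_summable hns] at hZ
    exact lt_irrefl _ hZ
  refine ⟨hsum.comp_injective Subtype.val_injective, ?_⟩
  have h3 := hC s hs hsum
  simp only [Function.comp] at h1
  rw [Real.log_mul hs1.ne' hZ.ne', Real.dist_eq] at h1
  have h4 := abs_le.mp h3
  have h5 := abs_lt.mp h1
  have h6 := neg_abs_le (Real.log ρ)
  have h7 := le_abs_self (Real.log ρ)
  rw [abs_le]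
  constructor <;> linarith [h4.1, h4.2, h5.1, h5.2]

lemma finite_support_bound (u : Nat.Primes → ℝ) (B : Finset Nat.Primes)
    (hB : ∀ p, p ∉ B → u p = 0) :
    ∀ s : ℝ, 0 < s → Summable (fun p : Nat.Primes => u p * (p : ℝ) ^ (-s)) ∧
      |∑' p : Nat.Primes, u p * (p : ℝ) ^ (-s)| ≤ ∑ p ∈ B, |u p| := by
  intro s hs
  have hz : ∀ p, p ∉ B → u p * ((p : ℕ) : ℝ) ^ (-s) = 0 := fun p hp => by rw [hB p hp, zero_mul]
  refine ⟨summable_of_ne_finset_zero hz, ?_⟩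
  rw [tsum_eq_sum hz]
  refine (Finset.abs_sum_le_sum_abs _ _).trans (Finset.sum_le_sum fun p _ => ?_)
  rw [abs_mul, abs_of_nonneg (by positivity : (0 : ℝ) ≤ ((p : ℕ) : ℝ) ^ (-s))]
  refine mul_le_of_le_one_right (abs_nonneg _) ?_
  exact Real.rpow_le_one_of_one_le_of_nonpos (by exact_mod_cast p.2.one_lt.le) (by linarith)

lemma nroots_bound (f : ℤ[X]) (hf : f.Monic) (hirr : Irreducible f) :
    ∃ C : ℝ, ∀ᶠ s : ℝ in 𝓝[>] 1,
      Summable (fun p : Nat.Primes => (nroots f p : ℝ) * (p : ℝ) ^ (-s)) ∧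
      |∑' p : Nat.Primes, (nroots f p : ℝ) * (p : ℝ) ^ (-s) + Real.log (s - 1)| ≤ C := by
  classical
  set g : ℚ[X] := f.map (algebraMap ℤ ℚ) with hg
  have hgirr : Irreducible g := (hf.irreducible_iff_irreducible_map_fraction_map).mp hirr
  have hgm : g.Monic := hf.map _
  haveI := Fact.mk hgirr
  haveI : FiniteDimensional ℚ (AdjoinRoot g) := (AdjoinRoot.powerBasis hgirr.ne_zero).finite
  haveI : NumberField (AdjoinRoot g) := { }
  have hroot : IsIntegral ℤ (AdjoinRoot.root g) := by
    refine ⟨f, hf, ?_⟩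
    have e1 : algebraMap ℤ (AdjoinRoot g) = (AdjoinRoot.of g).comp (algebraMap ℤ ℚ) :=
      RingHom.ext_int _ _
    rw [e1, ← eval₂_map]
    exact AdjoinRoot.eval₂_root g
  let θ : 𝓞 (AdjoinRoot g) := ⟨AdjoinRoot.root g, hroot⟩
  have hθ : Algebra.adjoin ℚ {(θ : AdjoinRoot g)} = ⊤ := AdjoinRoot.adjoinRoot_eq_top
  have hmin : minpoly ℤ θ = f := by
    have h1 : minpoly ℤ θ = minpoly ℤ (AdjoinRoot.root g) :=
      (minpoly.algebraMap_eq (B := 𝓞 (AdjoinRoot g)) (B' := AdjoinRoot g)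
        (RingOfIntegers.coe_injective) θ).symm
    have h2 := minpoly.isIntegrallyClosed_eq_field_fractions' ℚ hroot
    have h3 : minpoly ℚ (AdjoinRoot.root g) = g := by
      refine (minpoly.eq_of_irreducible_of_monic hgirr ?_ hgm).symm
      rw [aeval_def, Subsingleton.elim (algebraMap ℚ (AdjoinRoot g)) (AdjoinRoot.of g)]
      exact AdjoinRoot.eval₂_root g
    rw [h3, hg] at h2
    rw [h1]
    exact (Polynomial.map_injective _ (RingHom.injective_int (algebraMap ℤ ℚ)) h2).symm
  have hexp := exponent_ne_zero hθ
  obtain ⟨C, hC⟩ := zeta_bound (AdjoinRoot g)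
  have hfin : {p : Nat.Primes | (p : ℕ) ∣ exponent θ}.Finite := by
    refine Set.Finite.of_finite_image (f := ((↑) : Nat.Primes → ℕ)) ?_
      (Subtype.val_injective.injOn)
    refine (Nat.divisors (exponent θ)).finite_toSet.subset ?_
    rintro _ ⟨p, hp, rfl⟩
    simpa using ⟨hp, hexp⟩
  set u : Nat.Primes → ℝ := fun p => (nroots f p : ℝ) - (rr (AdjoinRoot g) p : ℝ) with hu
  have hu0 : ∀ p, p ∉ hfin.toFinset → u p = 0 := by
    intro p hp
    have hp' : ¬ (p : ℕ) ∣ exponent θ := by simpa using hp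
    have := rr_prime p.2 hp'
    rw [hmin] at this
    simp [hu, this]
  refine ⟨C + ∑ p ∈ hfin.toFinset, |u p|, ?_⟩
  filter_upwards [hC, self_mem_nhdsWithin] with s hs hs1
  have hs1 : (1 : ℝ) < s := hs1
  obtain ⟨h1, h2⟩ := finite_support_bound u _ hu0 s (by linarith)
  have heq : ∀ p : Nat.Primes, (nroots f p : ℝ) * (p : ℝ) ^ (-s) =
      (rr (AdjoinRoot g) p : ℝ) * (p : ℝ) ^ (-s) + u p * (p : ℝ) ^ (-s) := by
    intro p; simp only [hu]; ring
  simp_rw [heq]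
  refine ⟨hs.1.add h1, ?_⟩
  rw [hs.1.tsum_add h1]
  calc _ = |(∑' p : Nat.Primes, (rr (AdjoinRoot g) p : ℝ) * (p : ℝ) ^ (-s) + Real.log (s - 1)) +
        ∑' p : Nat.Primes, u p * (p : ℝ) ^ (-s)| := by congr 1; ring
    _ ≤ _ := (abs_add_le _ _).trans (add_le_add hs.2 h2)

lemma nroots_X_pow (q p A : ℕ) : nroots (X ^ q - C (A : ℤ)) p =
    Nat.card {x : ZMod p // x ^ q = (A : ZMod p)} := by
  unfold nroots
  refine Nat.card_congr (Equiv.subtypeEquivRight fun x => ?_)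
  simp [sub_eq_zero]

lemma nroots_not_one {q p : ℕ} (hq : q.Prime) (hp : p.Prime) (h : p % q ≠ 1) (A : ℕ) :
    nroots (X ^ q - C (A : ℤ)) p = 1 := by
  have : Fact p.Prime := ⟨hp⟩
  rw [nroots_X_pow]
  have hcop : (Nat.card (ZMod p)ˣ).Coprime q := by
    rw [Nat.card_eq_fintype_card, ZMod.card_units, Nat.coprime_comm, hq.coprime_iff_not_dvd]
    rintro ⟨k, hk⟩
    apply h
    have : p = 1 + q * k := by have := hp.pos; omega
    rw [this, Nat.add_mul_mod_self_left, Nat.mod_eq_of_lt hq.one_lt]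
  have hinj : Function.Injective (fun x : ZMod p => x ^ q) := by
    intro x y hxy
    simp only at hxy
    by_cases hx : x = 0
    · subst hx
      rw [zero_pow hq.ne_zero] at hxy
      exact (pow_eq_zero_iff hq.ne_zero |>.mp hxy.symm).symm
    · have hy : y ≠ 0 := by
        rintro rfl
        rw [zero_pow hq.ne_zero] at hxy
        exact hx (pow_eq_zero_iff hq.ne_zero |>.mp hxy)
      have h1 : (powCoprime hcop) (Units.mk0 x hx) = (powCoprime hcop) (Units.mk0 y hy) := by
        ext
        simpa [powCoprime] using hxy
      have h2 := (powCoprime hcop).injective h1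
      simpa using congrArg Units.val h2
  have hbij := Finite.injective_iff_bijective.mp hinj
  obtain ⟨x, hx, hu⟩ := hbij.existsUnique (A : ZMod p)
  rw [Nat.card_eq_one_iff_unique]
  exact ⟨⟨fun a b => Subtype.ext ((hu _ a.2).trans (hu _ b.2).symm)⟩, ⟨⟨x, hx⟩⟩⟩

lemma exists_surj {q p : ℕ} (hp : p.Prime) (hq : q.Prime) (h : p % q = 1) :
    ∃ φ : (ZMod p)ˣ →* Multiplicative (ZMod q), Function.Surjective φ := by
  have : Fact p.Prime := ⟨hp⟩
  have hdvd : q ∣ Nat.card (ZMod p)ˣ := by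
    rw [Nat.card_eq_fintype_card, ZMod.card_units]
    exact (Nat.modEq_iff_dvd' hp.one_lt.le).mp (by
      rw [Nat.ModEq, h, Nat.mod_eq_of_lt hq.one_lt])
  let e : Multiplicative (ZMod (Nat.card (ZMod p)ˣ)) ≃* (ZMod p)ˣ := zmodCyclicMulEquiv inferInstance
  let ψ : ZMod (Nat.card (ZMod p)ˣ) →+ ZMod q := (ZMod.castHom hdvd (ZMod q)).toAddMonoidHom
  refine ⟨(AddMonoidHom.toMultiplicative ψ).comp e.symm.toMonoidHom, ?_⟩
  have h1 : Function.Surjective ψ := ZMod.castHom_surjective hdvd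
  have h2 : Function.Surjective (AddMonoidHom.toMultiplicative ψ) := h1
  exact h2.comp e.symm.surjective

lemma nroots_of_surj {q p : ℕ} (hp : p.Prime) (hq : q.Prime) (h : p % q = 1)
    (φ : (ZMod p)ˣ →* Multiplicative (ZMod q)) (hφ : Function.Surjective φ)
    (A : ℕ) (u : (ZMod p)ˣ) (hu : (u : ZMod p) = (A : ZMod p)) [Decidable (φ u = 1)] :
    nroots (X ^ q - C (A : ℤ)) p = if φ u = 1 then q else 0 := by
  have : Fact p.Prime := ⟨hp⟩
  have : NeZero q := ⟨hq.ne_zero⟩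
  have hdvd : q ∣ Nat.card (ZMod p)ˣ := by
    rw [Nat.card_eq_fintype_card, ZMod.card_units]
    exact (Nat.modEq_iff_dvd' hp.one_lt.le).mp (by
      rw [Nat.ModEq, h, Nat.mod_eq_of_lt hq.one_lt])
  have hpowq : ∀ z : Multiplicative (ZMod q), z ^ q = 1 := by
    intro z
    have : z ^ Nat.card (Multiplicative (ZMod q)) = 1 := pow_card_eq_one'
    simpa using this
  rw [nroots_X_pow, ← hu]
  have hle : (powMonoidHom q : (ZMod p)ˣ →* (ZMod p)ˣ).range ≤ φ.ker := by
    rintro _ ⟨x, rfl⟩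
    rw [MonoidHom.mem_ker, powMonoidHom_apply, map_pow, hpowq]
  have hcr : Nat.card (powMonoidHom q : (ZMod p)ˣ →* (ZMod p)ˣ).range =
      Nat.card (ZMod p)ˣ / q := by
    rw [IsCyclic.card_powMonoidHom_range, Nat.gcd_eq_right hdvd]
  have hck : Nat.card φ.ker * q = Nat.card (ZMod p)ˣ := by
    have h1 := Subgroup.card_mul_index φ.ker
    rw [Subgroup.index_ker, MonoidHom.range_eq_top.mpr hφ] at h1
    simpa using h1
  have heq : (powMonoidHom q : (ZMod p)ˣ →* (ZMod p)ˣ).range = φ.ker := by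
    apply Subgroup.eq_of_le_of_card_ge hle
    rw [hcr, ← hck, Nat.mul_div_cancel _ hq.pos]
  split_ifs with hone
  · have hmem : u ∈ (powMonoidHom q : (ZMod p)ˣ →* (ZMod p)ˣ).range := by
      rw [heq]; exact hone
    obtain ⟨y, rfl⟩ := hmem
    have hker : Nat.card (powMonoidHom q : (ZMod p)ˣ →* (ZMod p)ˣ).ker = q := by
      rw [IsCyclic.card_powMonoidHom_ker, Nat.gcd_eq_right hdvd]
    refine Eq.trans ?_ hker
    symm
    refine Nat.card_congr (Equiv.ofBijective
      (fun z => ⟨((y * z.1 : (ZMod p)ˣ) : ZMod p), ?_⟩) ⟨?_, ?_⟩)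
    · have hz : z.1 ^ q = 1 := z.2
      rw [← Units.val_pow_eq_pow_val, mul_pow, hz, mul_one]
      rfl
    · intro a b hab
      have h1 := congrArg Subtype.val hab
      simp only at h1
      exact Subtype.ext (mul_left_cancel (Units.ext h1))
    · rintro ⟨x, hx⟩
      have hx0 : x ≠ 0 := by
        rintro rfl
        rw [zero_pow hq.ne_zero] at hx
        exact (Units.ne_zero _) hx.symm
      refine ⟨⟨y⁻¹ * Units.mk0 x hx0, ?_⟩, ?_⟩
      · rw [MonoidHom.mem_ker, powMonoidHom_apply, mul_pow, inv_pow, inv_mul_eq_one]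
        ext
        rw [Units.val_pow_eq_pow_val _ q, Units.val_pow_eq_pow_val _ q, Units.val_mk0, hx]
        rfl
      · simp
  · rw [Nat.card_eq_zero]
    left
    refine ⟨fun ⟨x, hx⟩ => hone ?_⟩
    have hx0 : x ≠ 0 := by
      rintro rfl
      rw [zero_pow hq.ne_zero] at hx
      exact (Units.ne_zero _) hx.symm
    have : u = (Units.mk0 x hx0) ^ q := by ext; simp [hx]
    rw [this, map_pow, hpowq]

section comb
variable {ι : Type} [Fintype ι] {q : ℕ} [NeZero q]

/-- The linear functional with coefficients `c`. -/
def lin (c : ι → ZMod q) : (ι → ZMod q) →ₗ[ZMod q] ZMod q := ∑ i, c i • LinearMap.proj i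

lemma lin_apply (c a : ι → ZMod q) : lin c a = ∑ i, c i * a i := by
  simp [lin, LinearMap.sum_apply]

open Classical in
/-- The weight attached to a functional. -/
noncomputable def wt (c : (ι → ZMod q) →ₗ[ZMod q] ZMod q) (a : ι → ZMod q) : ℝ :=
  (if c a = 0 then (q : ℝ) else 0) - 1

lemma sum_wt_zero [DecidableEq ι] (hq : q.Prime) (c : (ι → ZMod q) →ₗ[ZMod q] ZMod q)
    (b : ι → ZMod q) (hb : c b ≠ 0)
    (n : (ι → ZMod q) → ℝ) (hn : ∀ a (t : ZMod q), n (a + t • b) = n a) :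
    ∑ a, wt c a * n a = 0 := by
  classical
  have : Fact q.Prime := ⟨hq⟩
  have h1 : ∀ t : ZMod q, ∑ a, wt c (a + t • b) * n a = ∑ a, wt c a * n a := by
    intro t
    rw [← Equiv.sum_comp (Equiv.addRight (t • b)) (fun a => wt c a * n a)]
    refine Finset.sum_congr rfl fun a _ => ?_
    simp only [Equiv.coe_addRight]
    rw [hn]
  have h2 : ∑ t : ZMod q, ∑ a, wt c (a + t • b) * n a = 0 := by
    rw [Finset.sum_comm]
    refine Finset.sum_eq_zero fun a _ => ?_
    rw [← Finset.sum_mul]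
    have : ∑ t : ZMod q, wt c (a + t • b) = 0 := by
      simp only [wt]
      rw [Finset.sum_sub_distrib]
      have h3 : ∀ t : ZMod q, c (a + t • b) = 0 ↔ t = - c a / c b := by
        intro t
        rw [map_add, map_smul, smul_eq_mul, eq_div_iff hb]
        constructor
        · intro h; linear_combination h
        · intro h; linear_combination h
      simp_rw [h3]
      simp [ZMod.card]
    rw [this, zero_mul]
  simp_rw [h1] at h2
  simp only [Finset.sum_const, nsmul_eq_mul] at h2
  rcases mul_eq_zero.mp h2 with h | h
  · exfalso
    simp [ZMod.card] at h
    exact hq.ne_zero h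
  · exact h

lemma exists_scalar (hq : q.Prime) (c d : (ι → ZMod q) →ₗ[ZMod q] ZMod q) (hc : c ≠ 0)
    (h : ∀ b, d b = 0 → c b = 0) : ∃ l : ZMod q, l ≠ 0 ∧ ∀ a, c a = l * d a := by
  have : Fact q.Prime := ⟨hq⟩
  obtain ⟨b, hb⟩ : ∃ b, d b ≠ 0 := by
    by_contra hcon
    push Not at hcon
    exact hc (LinearMap.ext fun a => h a (hcon a))
  have key : ∀ a, c a = c b / d b * d a := by
    intro a
    have h1 := h (d b • a - d a • b) (by simp [mul_comm])
    rw [map_sub, map_smul, map_smul, smul_eq_mul, smul_eq_mul] at h1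
    field_simp
    linear_combination h1
  refine ⟨c b / d b, ?_, key⟩
  intro h0
  apply hc
  ext1 a
  rw [key a, h0, zero_mul, LinearMap.zero_apply]

lemma irr_aux (hq : q.Prime) (l : ι → ℕ) (hl : ∀ i, (l i).Prime) (hinj : Function.Injective l)
    (a : ι → ZMod q) (ha : a ≠ 0) :
    Irreducible (X ^ q - C ((∏ i, l i ^ (a i).val : ℕ) : ℤ) : ℤ[X]) := by
  classical
  set A : ℕ := ∏ i, l i ^ (a i).val with hA
  have hm : (X ^ q - C (A : ℤ) : ℤ[X]).Monic := monic_X_pow_sub_C _ hq.ne_zero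
  rw [hm.irreducible_iff_irreducible_map_fraction_map (K := ℚ)]
  have : (X ^ q - C (A : ℤ) : ℤ[X]).map (algebraMap ℤ ℚ) = X ^ q - C (A : ℚ) := by simp
  rw [this]
  apply X_pow_sub_C_irreducible_of_prime hq
  intro b hb
  have hden : b.den = 1 := by
    have h1 : (b ^ q).den = 1 := by rw [hb]; exact Rat.den_natCast A
    rw [Rat.den_pow] at h1
    exact (Nat.pow_eq_one.mp h1).resolve_right hq.ne_zero
  have hb2 : ((b.num : ℤ) : ℚ) = b := Rat.den_eq_one_iff b |>.mp hden
  have h3 : b.num ^ q = (A : ℤ) := by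
    have : (((b.num) ^ q : ℤ) : ℚ) = ((A : ℤ) : ℚ) := by
      push_cast
      rw [hb2, hb]
    exact_mod_cast this
  have h4 : b.num.natAbs ^ q = A := by
    have := congrArg Int.natAbs h3
    simpa [Int.natAbs_pow] using this
  obtain ⟨i, hi⟩ : ∃ i, a i ≠ 0 := by
    by_contra hcon
    push Not at hcon
    exact ha (funext hcon)
  have h5 : A.factorization (l i) = (a i).val := by
    rw [hA, Nat.factorization_prod (fun j _ => pow_ne_zero _ (hl j).ne_zero)]
    rw [Finset.sum_apply', Finset.sum_eq_single i]
    · rw [(hl i).factorization_pow]; simp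
    · intro j _ hj
      rw [(hl j).factorization_pow, Finsupp.single_eq_of_ne]
      exact fun h => hj (hinj h.symm)
    · simp
  rw [← h4, Nat.factorization_pow] at h5
  simp only [Finsupp.smul_apply, smul_eq_mul] at h5
  have h6 : (a i).val < q := ZMod.val_lt _
  have h7 : (a i).val ≠ 0 := by rwa [Ne, ZMod.val_eq_zero]
  rcases Nat.eq_zero_or_pos (b.num.natAbs.factorization (l i)) with h8 | h8
  · rw [h8] at h5; omega
  · nlinarith
end comb

lemma cyc_le {q p : ℕ} (hq : q.Prime) (hp : p.Prime) (hne : p ≠ q) :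
    nroots (cyclotomic q ℤ) p + 1 ≤ nroots (X ^ q - C ((1 : ℕ) : ℤ)) p := by
  classical
  have : Fact p.Prime := ⟨hp⟩
  have : Fact q.Prime := ⟨hq⟩
  rw [nroots_X_pow]
  unfold nroots
  rw [← Finite.card_option]
  have hcyc : ∀ x : ZMod p, ((cyclotomic q ℤ).map (Int.castRingHom (ZMod p))).eval x = 0 →
      x ^ q = 1 ∧ x ≠ 1 := by
    intro x hx
    rw [map_cyclotomic] at hx
    constructor
    · have h1 := cyclotomic_prime_mul_X_sub_one (ZMod p) q
      have h2 := congrArg (eval x) h1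
      rw [eval_mul, hx, zero_mul] at h2
      simp at h2
      exact (sub_eq_zero.mp h2.symm)
    · rintro rfl
      rw [eval_one_cyclotomic_prime] at hx
      rw [ZMod.natCast_eq_zero_iff] at hx
      exact hne ((Nat.prime_dvd_prime_iff_eq hp hq).mp hx)
  let F : Option {x : ZMod p // ((cyclotomic q ℤ).map (Int.castRingHom (ZMod p))).eval x = 0} →
      {x : ZMod p // x ^ q = ((1 : ℕ) : ZMod p)} := fun o => match o with
    | none => ⟨1, by simp⟩
    | some x => ⟨x.1, by simpa using (hcyc x.1 x.2).1⟩
  refine Nat.card_le_card_of_injective F ?_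
  rintro (_ | x) (_ | y) hxy
  · rfl
  · exact absurd (congrArg Subtype.val hxy).symm (hcyc y.1 y.2).2
  · exact absurd (congrArg Subtype.val hxy) (hcyc x.1 x.2).2
  · have h1 : (F (some x)).1 = (F (some y)).1 := congrArg Subtype.val hxy
    exact congrArg some (Subtype.ext h1)

lemma phi_prod {ι : Type} [Fintype ι] {q p : ℕ} [NeZero q]
    (φ : (ZMod p)ˣ →* Multiplicative (ZMod q)) (u : ι → (ZMod p)ˣ) (a : ι → ZMod q) :
    φ (∏ i, u i ^ (a i).val) =
      Multiplicative.ofAdd (lin (fun i => Multiplicative.toAdd (φ (u i))) a) := by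
  rw [map_prod, lin_apply, ofAdd_sum]
  refine Finset.prod_congr rfl fun i _ => ?_
  rw [map_pow]
  apply Multiplicative.toAdd.injective
  rw [toAdd_pow, toAdd_ofAdd, nsmul_eq_mul, ZMod.natCast_zmod_val, mul_comm]

/-- The property of being a good prime. -/
def Good {ι : Type} (q : ℕ) (l : ι → ℕ) (c : ι → ZMod q) (p : ℕ) : Prop :=
  p.Prime ∧ p % q = 1 ∧ (∀ i, p ≠ l i) ∧
    ∃ φ : (ZMod p)ˣ →* Multiplicative (ZMod q), Function.Surjective φ ∧
      ∀ i, ∀ u : (ZMod p)ˣ, (u : ZMod p) = (l i : ZMod p) → φ u = Multiplicative.ofAdd (c i)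

lemma main_vanish {ι : Type} [Fintype ι] [DecidableEq ι] {q : ℕ} [NeZero q] (hq : q.Prime)
    (l : ι → ℕ) (hl : ∀ i, (l i).Prime) (c : ι → ZMod q) (hc : c ≠ 0) (p : ℕ) (hp : p.Prime)
    (hpl : ∀ i, p ≠ l i) (hbad : ¬ Good q l c p) :
    ∑ a : ι → ZMod q, wt (lin c) a *
      (nroots (X ^ q - C ((∏ i, l i ^ (a i).val : ℕ) : ℤ)) p : ℝ) = 0 := by
  classical
  have : Fact q.Prime := ⟨hq⟩
  have : Fact p.Prime := ⟨hp⟩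
  have hcs : ∀ i, lin c (Pi.single i 1) = c i := by
    intro i
    rw [lin_apply, Finset.sum_eq_single i]
    · simp
    · intro j _ hj; simp [Pi.single_eq_of_ne hj]
    · simp
  obtain ⟨i0, hi0⟩ : ∃ i, c i ≠ 0 := by
    by_contra hcon
    push Not at hcon
    exact hc (_root_.funext hcon)
  by_cases hpq : p % q = 1
  · obtain ⟨φ, hφ⟩ := exists_surj hp hq hpq
    have hu : ∀ i, ∃ u : (ZMod p)ˣ, (u : ZMod p) = (l i : ZMod p) := by
      intro i
      refine ⟨Units.mk0 (l i : ZMod p) ?_, rfl⟩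
      rw [Ne, ZMod.natCast_eq_zero_iff]
      intro h
      exact hpl i ((Nat.prime_dvd_prime_iff_eq hp (hl i)).mp h)
    choose u hu using hu
    set d : ι → ZMod q := fun i => Multiplicative.toAdd (φ (u i)) with hd
    have hn : ∀ a : ι → ZMod q, nroots (X ^ q - C ((∏ i, l i ^ (a i).val : ℕ) : ℤ)) p =
        if lin d a = 0 then q else 0 := by
      intro a
      rw [nroots_of_surj hp hq hpq φ hφ _ (∏ i, u i ^ (a i).val) (by
        push_cast
        simp_rw [← hu]
        )]
      rw [phi_prod]
      simp only [ofAdd_eq_one, hd]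
    simp_rw [hn]
    by_cases hex : ∃ b, lin d b = 0 ∧ lin c b ≠ 0
    · obtain ⟨b, hb1, hb2⟩ := hex
      refine sum_wt_zero hq (lin c) b hb2 _ fun a t => ?_
      rw [map_add, map_smul, hb1, smul_zero, add_zero]
    · exfalso
      push Not at hex
      have hlc : lin c ≠ 0 := by
        intro h
        apply hi0
        rw [← hcs, h, LinearMap.zero_apply]
      obtain ⟨t, ht0, ht⟩ := exists_scalar hq (lin c) (lin d) hlc hex
      apply hbad
      have hds : ∀ i, lin d (Pi.single i 1) = d i := by
        intro i
        rw [lin_apply, Finset.sum_eq_single i]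
        · simp
        · intro j _ hj; simp [Pi.single_eq_of_ne hj]
        · simp
      refine ⟨hp, hpq, hpl, (AddMonoidHom.toMultiplicative (AddMonoidHom.mulLeft t)).comp φ,
        ?_, ?_⟩
      · have h1 : Function.Surjective (AddMonoidHom.toMultiplicative (AddMonoidHom.mulLeft t)) := by
          intro y
          refine ⟨Multiplicative.ofAdd (t⁻¹ * Multiplicative.toAdd y), ?_⟩
          apply Multiplicative.toAdd.injective
          simp [ht0]
        exact h1.comp hφ
      · intro i v hv
        have : v = u i := Units.ext (hv.trans (hu i).symm)
        subst this
        rw [← hcs i, ht, hds]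
        rfl
  · simp_rw [nroots_not_one hq hp hpq]
    exact sum_wt_zero hq (lin c) (Pi.single i0 1) (by rwa [hcs]) _ fun _ _ => rfl

lemma main_infinite {ι : Type} [Fintype ι] [DecidableEq ι] {q : ℕ} [NeZero q] (hq : q.Prime)
    (l : ι → ℕ) (hl : ∀ i, (l i).Prime) (hinj : Function.Injective l)
    (c : ι → ZMod q) (hc : c ≠ 0) : {p : ℕ | Good q l c p}.Infinite := by
  classical
  intro hfin
  have : Fact q.Prime := ⟨hq⟩
  set N : (ι → ZMod q) → Nat.Primes → ℝ := fun a p =>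
    (nroots (X ^ q - C ((∏ i, l i ^ (a i).val : ℕ) : ℤ)) p : ℝ) with hN
  set g : Nat.Primes → ℝ := fun p => ∑ a, wt (lin c) a * N a p with hg
  have hBfin : {p : Nat.Primes | Good q l c p ∨ ∃ i, (p : ℕ) = l i}.Finite := by
    refine Set.Finite.of_finite_image (f := ((↑) : Nat.Primes → ℕ)) ?_
      (Subtype.val_injective.injOn)
    refine (hfin.union (Set.finite_range l)).subset ?_
    rintro _ ⟨p, hp | ⟨i, hi⟩, rfl⟩
    · exact Or.inl hp
    · exact Or.inr ⟨i, hi.symm⟩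
  have hg0 : ∀ p, p ∉ hBfin.toFinset → g p = 0 := by
    intro p hp
    simp only [Set.Finite.mem_toFinset, Set.mem_ofPred_eq, not_or, not_exists] at hp
    exact main_vanish hq l hl c hc p p.2 hp.2 hp.1
  have hgb := finite_support_bound g _ hg0
  set Cg := ∑ p ∈ hBfin.toFinset, |g p|
  -- nonzero vectors
  have hpos : ∀ a : ι → ZMod q, ∃ D : ℝ, a ≠ 0 → ∀ᶠ s : ℝ in 𝓝[>] 1,
      Summable (fun p : Nat.Primes => N a p * (p : ℝ) ^ (-s)) ∧
      |∑' p : Nat.Primes, N a p * (p : ℝ) ^ (-s) + Real.log (s - 1)| ≤ D := by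
    intro a
    by_cases ha : a = 0
    · exact ⟨0, fun h => absurd ha h⟩
    · obtain ⟨D, hD⟩ := nroots_bound _ (monic_X_pow_sub_C _ hq.ne_zero) (irr_aux hq l hl hinj a ha)
      exact ⟨D, fun _ => hD⟩
  choose D hD using hpos
  have hDall : ∀ᶠ s : ℝ in 𝓝[>] 1, ∀ a : ι → ZMod q, a ≠ 0 →
      Summable (fun p : Nat.Primes => N a p * (p : ℝ) ^ (-s)) ∧
      |∑' p : Nat.Primes, N a p * (p : ℝ) ^ (-s) + Real.log (s - 1)| ≤ D a := by
    rw [eventually_all]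
    intro a
    by_cases ha : a = 0
    · exact Eventually.of_forall fun s h => absurd ha h
    · filter_upwards [hD a ha] with s hs _ using hs
  -- the zero vector
  have hN0 : ∀ p : Nat.Primes, N 0 p = (nroots (X ^ q - C ((1 : ℕ) : ℤ)) p : ℝ) := by
    intro p
    simp [hN]
  have hN0le : ∀ p : Nat.Primes, N 0 p ≤ q := by
    intro p
    rw [hN0]
    have hle : nroots (X ^ q - C ((1 : ℕ) : ℤ)) p ≤ q := by
      by_cases hpq : (p : ℕ) % q = 1
      · obtain ⟨φ, hφ⟩ := exists_surj p.2 hq hpq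
        rw [nroots_of_surj p.2 hq hpq φ hφ 1 1 (by simp)]
        simp
      · rw [nroots_not_one hq p.2 hpq]
        exact hq.one_lt.le
    exact_mod_cast hle
  obtain ⟨C1, hC1⟩ := nroots_bound (cyclotomic q ℤ) (cyclotomic.monic q ℤ)
    (cyclotomic.irreducible hq.pos)
  obtain ⟨C2, hC2⟩ := nroots_bound X monic_X irreducible_X
  have hX : ∀ p : Nat.Primes, nroots X p = 1 := by
    intro p
    unfold nroots
    simp
  set v : Nat.Primes → ℝ := fun p => if (p : ℕ) = q then
    (nroots (cyclotomic q ℤ) p : ℝ) + (nroots X p : ℝ) else 0 with hv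
  have hv0 : ∀ p, p ∉ ({⟨q, hq⟩} : Finset Nat.Primes) → v p = 0 := by
    intro p hp
    have hpq : (p : ℕ) ≠ q := fun h => hp (Finset.mem_singleton.mpr (Subtype.ext h))
    simp only [hv]
    rw [if_neg hpq]
  have hvb := finite_support_bound v _ hv0
  set Cv := ∑ p ∈ ({⟨q, hq⟩} : Finset Nat.Primes), |v p|
  have hineq : ∀ p : Nat.Primes, (nroots (cyclotomic q ℤ) p : ℝ) + (nroots X p : ℝ) ≤
      N 0 p + v p := by
    intro p
    have hnn : 0 ≤ N 0 p := by rw [hN0]; positivity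
    simp only [hv]
    split_ifs with h
    · linarith
    · have := cyc_le hq p.2 h
      rw [hN0, hX]
      have h2 : ((nroots (cyclotomic q ℤ) p + 1 : ℕ) : ℝ) ≤ (nroots (X ^ q - C ((1 : ℕ) : ℤ)) p : ℝ) := by
        exact_mod_cast this
      push_cast at h2 ⊢
      linarith
  have hsumw : ∑ a, wt (lin c) a = 0 := by
    obtain ⟨i0, hi0⟩ : ∃ i, c i ≠ 0 := by
      by_contra hcon
      push Not at hcon
      exact hc (_root_.funext hcon)
    have := sum_wt_zero hq (lin c) (Pi.single i0 1) (by
      rw [lin_apply, Finset.sum_eq_single i0]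
      · simpa using hi0
      · intro j _ hj; simp [Pi.single_eq_of_ne hj]
      · simp) (fun _ => 1) fun _ _ => rfl
    simpa using this
  have hw0 : wt (lin c) 0 = q - 1 := by simp [wt]
  have hqr : (1 : ℝ) < q := by exact_mod_cast hq.one_lt
  -- log goes to minus infinity
  have hD0 : ∀ a : ι → ZMod q, a ≠ 0 → 0 ≤ D a := by
    intro a ha
    obtain ⟨s, hs⟩ := (hD a ha).exists
    exact (abs_nonneg _).trans hs.2
  set T : ℝ := Cg + ∑ a ∈ Finset.univ.erase (0 : ι → ZMod q), |wt (lin c) a| * D a with hT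
  have hlog : ∀ᶠ s : ℝ in 𝓝[>] 1, Real.log (s - 1) < - (C1 + C2 + Cv) - T / (q - 1) := by
    have h1 : Tendsto (fun s : ℝ => s - 1) (𝓝[>] 1) (𝓝[>] 0) := by
      refine tendsto_nhdsWithin_iff.mpr ⟨?_, ?_⟩
      · have : Tendsto (fun s : ℝ => s - 1) (𝓝 1) (𝓝 (1 - 1)) :=
          (continuous_id.sub continuous_const).tendsto 1
        rw [sub_self] at this
        exact this.mono_left nhdsWithin_le_nhds
      · filter_upwards [self_mem_nhdsWithin] with s hs
        have hs : (1 : ℝ) < s := hs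
        exact sub_pos.mpr hs
    exact (Real.tendsto_log_nhdsGT_zero.comp h1).eventually (eventually_lt_atBot _)
  have hgt : ∀ᶠ s : ℝ in 𝓝[>] 1, 1 < s := self_mem_nhdsWithin
  obtain ⟨s, hs1, hsD, hs2, hs3, hsl⟩ := (hgt.and (hDall.and (hC1.and (hC2.and hlog)))).exists
  set L := Real.log (s - 1) with hL
  set Z : (ι → ZMod q) → ℝ := fun a => ∑' p : Nat.Primes, N a p * (p : ℝ) ^ (-s) with hZ
  have hpp : ∀ p : Nat.Primes, (0 : ℝ) ≤ (p : ℝ) ^ (-s) := fun p => by positivity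
  have hS0 : Summable (fun p : Nat.Primes => N 0 p * (p : ℝ) ^ (-s)) := by
    refine Summable.of_nonneg_of_le (fun p => ?_) (fun p => ?_)
      ((Nat.Primes.summable_rpow (r := -s).mpr (by linarith)).mul_left (q : ℝ))
    · rw [hN0]; positivity
    · exact mul_le_mul_of_nonneg_right (hN0le p) (hpp p)
  have hSa : ∀ a : ι → ZMod q, Summable (fun p : Nat.Primes => N a p * (p : ℝ) ^ (-s)) := by
    intro a
    by_cases ha : a = 0
    · rw [ha]; exact hS0
    · exact (hsD a ha).1
  obtain ⟨hvs, hvbd⟩ := hvb s (by linarith)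
  obtain ⟨hgs, hgbd⟩ := hgb s (by linarith)
  -- lower bound
  have hlow : -L - L - (C1 + C2 + Cv) ≤ Z 0 := by
    have h1 : ∑' p : Nat.Primes, (nroots (cyclotomic q ℤ) p : ℝ) * (p : ℝ) ^ (-s) +
        ∑' p : Nat.Primes, (nroots X p : ℝ) * (p : ℝ) ^ (-s) ≤
        Z 0 + ∑' p : Nat.Primes, v p * (p : ℝ) ^ (-s) := by
      rw [← hs2.1.tsum_add hs3.1, hZ, ← hS0.tsum_add hvs]
      refine Summable.tsum_le_tsum (fun p => ?_) (hs2.1.add hs3.1) (hS0.add hvs)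
      have := mul_le_mul_of_nonneg_right (hineq p) (hpp p)
      linarith
    have h2 := (abs_le.mp hs2.2).1
    have h3 := (abs_le.mp hs3.2).1
    have h4 := (abs_le.mp hvbd).2
    linarith
  -- the identity
  have hid : ∑' p : Nat.Primes, g p * (p : ℝ) ^ (-s) = ∑ a, wt (lin c) a * (Z a + L) := by
    have h1 : ∀ p : Nat.Primes, g p * (p : ℝ) ^ (-s) =
        ∑ a, wt (lin c) a * (N a p * (p : ℝ) ^ (-s)) := by
      intro p
      simp only [hg]
      rw [Finset.sum_mul]
      exact Finset.sum_congr rfl fun a _ => by ring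
    simp_rw [h1]
    rw [Summable.tsum_finsetSum (fun a _ => (hSa a).mul_left _)]
    simp_rw [tsum_mul_left, mul_add]
    rw [Finset.sum_add_distrib, ← Finset.sum_mul, hsumw, zero_mul, add_zero]
  rw [← Finset.add_sum_erase _ _ (Finset.mem_univ (0 : ι → ZMod q)), hw0] at hid
  have hrest : |∑ a ∈ Finset.univ.erase (0 : ι → ZMod q), wt (lin c) a * (Z a + L)| ≤
      ∑ a ∈ Finset.univ.erase (0 : ι → ZMod q), |wt (lin c) a| * D a := by
    refine (Finset.abs_sum_le_sum_abs _ _).trans (Finset.sum_le_sum fun a ha => ?_)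
    rw [abs_mul]
    exact mul_le_mul_of_nonneg_left (hsD a (Finset.ne_of_mem_erase ha)).2 (abs_nonneg _)
  have h5 := (abs_le.mp hrest).1
  have h6 := (abs_le.mp hgbd).2
  have h7 : ((q : ℝ) - 1) * (Z 0 + L) ≤ T := by
    rw [hT]; linarith
  have hq1 : (0 : ℝ) < q - 1 := by linarith
  have h8 : Z 0 + L ≤ T / (q - 1) := by
    rw [le_div_iff₀ hq1]; linarith
  linarith

end three
end CharLemma

namespace CharLemma

lemma phi_nat {p q : ℕ} (φ : (ZMod p)ˣ →* Multiplicative (ZMod q)) (n : ℕ) (hn : n ≠ 0)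
    (u : (ZMod p)ˣ) (hu : (u : ZMod p) = (n : ZMod p)) (w : ℕ → (ZMod p)ˣ)
    (hw : ∀ l ∈ n.primeFactors, (w l : ZMod p) = (l : ZMod p)) :
    Multiplicative.toAdd (φ u) = ∑ l ∈ n.primeFactors,
      (n.factorization l : ZMod q) * Multiplicative.toAdd (φ (w l)) := by
  have h1 : u = ∏ l ∈ n.primeFactors, w l ^ n.factorization l := by
    ext
    rw [hu, Units.coe_prod]
    conv_lhs => rw [← Nat.prod_factorization_pow_eq_self hn]
    rw [Finsupp.prod, Nat.support_factorization, Nat.cast_prod]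
    refine Finset.prod_congr rfl fun l hl => ?_
    rw [Units.val_pow_eq_pow_val, hw l hl, Nat.cast_pow]
  rw [h1, map_prod, toAdd_prod]
  refine Finset.sum_congr rfl fun l _ => ?_
  rw [map_pow, toAdd_pow, nsmul_eq_mul]

lemma phi_neg_one {p q : ℕ} (hodd : Odd q) [NeZero q]
    (φ : (ZMod p)ˣ →* Multiplicative (ZMod q)) : φ (-1) = 1 := by
  have hpowq : ∀ z : Multiplicative (ZMod q), z ^ q = 1 := by
    intro z
    have : z ^ Nat.card (Multiplicative (ZMod q)) = 1 := pow_card_eq_one'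
    simpa using this
  have h1 : (-1 : (ZMod p)ˣ) ^ q = -1 := hodd.neg_one_pow
  rw [← h1, map_pow, hpowq]

lemma mem_qPrimes {q : ℕ} {S : Finset ℤ} {l : ℕ} : l ∈ qPrimes q S ↔
    ∃ s ∈ S, l ∈ s.natAbs.primeFactors ∧ ¬ q ∣ s.natAbs.factorization l := by
  simp [qPrimes, Finset.mem_sup]

end CharLemma

/-- **Lemma (character lemma over ℚ).** For every `F_q`-linear map `χ : F_q^n → F_q` there are
infinitely many primes `p ≡ 1 (mod q)` dividing no element of `S` and carrying a surjective
homomorphism `φ : (ℤ/pℤ)ˣ → ℤ/qℤ` with `φ(s mod p) = χ(π_q(s))` for all `s ∈ S`. -/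
theorem stmt2 (q : ℕ) (hq : q.Prime) (hodd : Odd q)
    (S : Finset ℤ) (hS0 : ∀ s ∈ S, s ≠ 0) (hSpow : ∀ s ∈ S, ¬ IsPerfectPow q s)
    (χ : (Fin (qPrimes q S).card → ZMod q) →ₗ[ZMod q] ZMod q) :
    {p : ℕ | p.Prime ∧ p % q = 1 ∧ (∀ s ∈ S, ¬ (p : ℤ) ∣ s) ∧
      ∃ φ : (ZMod p)ˣ →* Multiplicative (ZMod q), Function.Surjective φ ∧
        ∀ s ∈ S, ∀ u : (ZMod p)ˣ, (u : ZMod p) = (s : ZMod p) →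
          φ u = Multiplicative.ofAdd (χ (vecOf q (qPrimes q S) s))}.Infinite := by
  classical
  have hne : NeZero q := ⟨hq.ne_zero⟩
  have hfact : Fact q.Prime := ⟨hq⟩
  have hhprime : ∀ l ∈ (qPrimes q S), l.Prime := by
    intro l hl
    obtain ⟨s, _, h, _⟩ := CharLemma.mem_qPrimes.mp hl
    exact Nat.prime_of_mem_primeFactors h
  obtain ⟨l0, hl0ge, hl0⟩ := Nat.exists_infinite_primes ((qPrimes q S).sup id + 1)
  have hl0n : l0 ∉ (qPrimes q S) := by
    intro h
    have : l0 ≤ (qPrimes q S).sup id := Finset.le_sup (f := id) h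
    omega
  let e : Fin (qPrimes q S).card ≃o (qPrimes q S) := (qPrimes q S).orderIsoOfFin rfl
  let l : Option (Fin (qPrimes q S).card) → ℕ := fun o => o.elim l0 (fun i => (e i).1)
  let c : Option (Fin (qPrimes q S).card) → ZMod q := fun o => o.elim 1 (fun i => χ (Pi.single i 1))
  have hl : ∀ o, (l o).Prime := by
    rintro (_ | i)
    · exact hl0
    · exact hhprime _ (e i).2
  have hinj : Function.Injective l := by
    rintro (_ | i) (_ | j) h
    · rfl
    · exact absurd (show l0 = (e j).1 from h) (fun h' => hl0n (h' ▸ (e j).2))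
    · exact absurd (show (e i).1 = l0 from h) (fun h' => hl0n (h' ▸ (e i).2))
    · have h' : (e i).1 = (e j).1 := h
      exact congrArg some (e.injective (Subtype.ext h'))
  have hc : c ≠ 0 := by
    intro h
    have := congrFun h none
    exact one_ne_zero this
  have hinf := CharLemma.main_infinite hq l hl hinj c hc
  have hfin : {p : ℕ | ∃ s ∈ S, (p : ℤ) ∣ s}.Finite := by
    refine (S.biUnion fun s => s.natAbs.divisors).finite_toSet.subset ?_
    rintro p ⟨s, hs, hps⟩
    simp only [Finset.coe_biUnion, Set.mem_iUnion]
    refine ⟨s, hs, ?_⟩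
    simp only [Finset.mem_coe, Nat.mem_divisors]
    exact ⟨Int.natCast_dvd.mp hps, by simpa using hS0 s hs⟩
  refine (hinf.sdiff hfin).mono ?_
  rintro p ⟨⟨hp, hpq, hpl, φ, hφ, hφl⟩, hpS⟩
  have hpfact : Fact p.Prime := ⟨hp⟩
  have hpS' : ∀ s ∈ S, ¬ (p : ℤ) ∣ s := fun s hs h => hpS ⟨s, hs, h⟩
  refine ⟨hp, hpq, hpS', φ, hφ, fun s hs u hu => ?_⟩
  have hs0 := hS0 s hs
  set n := s.natAbs with hn
  have hn0 : n ≠ 0 := by simpa [hn] using hs0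
  have hpn : ¬ p ∣ n := fun h => hpS' s hs (Int.natCast_dvd.mpr h)
  -- reduce to the absolute value
  obtain ⟨u', hu', hφu⟩ : ∃ u' : (ZMod p)ˣ, (u' : ZMod p) = (n : ZMod p) ∧ φ u = φ u' := by
    rcases Int.natAbs_eq s with h | h
    · refine ⟨u, ?_, rfl⟩
      rw [hu]
      conv_lhs => rw [h]
      simp [hn]
    · refine ⟨-u, ?_, ?_⟩
      · rw [Units.val_neg, hu]
        conv_lhs => rw [h]
        simp [hn]
      · rw [← neg_one_mul u, map_mul, CharLemma.phi_neg_one hodd, one_mul]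
  rw [hφu]
  let w : ℕ → (ZMod p)ˣ := fun m => if h : (m : ZMod p) ≠ 0 then Units.mk0 (m : ZMod p) h else 1
  have hw : ∀ m : ℕ, (m : ZMod p) ≠ 0 → (w m : ZMod p) = m := by
    intro m hm
    simp only [w, dif_pos hm, Units.val_mk0]
  have hw1 : ∀ m ∈ n.primeFactors, (w m : ZMod p) = (m : ZMod p) := by
    intro m hm
    apply hw
    rw [Ne, ZMod.natCast_eq_zero_iff]
    intro h
    exact hpn (h.trans (Nat.dvd_of_mem_primeFactors hm))
  have hmain := CharLemma.phi_nat φ n hn0 u' hu' w hw1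
  have hsum : ∑ m ∈ n.primeFactors, (n.factorization m : ZMod q) * Multiplicative.toAdd (φ (w m)) =
      ∑ m ∈ (qPrimes q S), (n.factorization m : ZMod q) * Multiplicative.toAdd (φ (w m)) := by
    refine Eq.trans (Finset.sum_subset (Finset.subset_union_left (s₂ := qPrimes q S)) ?_)
      (Finset.sum_subset (Finset.subset_union_right (s₁ := n.primeFactors) (s₂ := qPrimes q S))
        ?_).symm
    rotate_left
    · intro m hm hmm
      have : q ∣ n.factorization m := by
        by_contra hcon
        apply hmm
        refine CharLemma.mem_qPrimes.mpr ⟨s, hs, ?_, hcon⟩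
        rcases Finset.mem_union.mp hm with h | h
        · exact h
        · exact absurd h hmm
      rw [(ZMod.natCast_eq_zero_iff _ _).mpr this, zero_mul]
    · intro m hm hmn
      rw [← Nat.support_factorization, Finsupp.notMem_support_iff] at hmn
      rw [hmn, Nat.cast_zero, zero_mul]
  apply Multiplicative.toAdd.injective
  rw [hmain, hsum, toAdd_ofAdd, LinearMap.pi_apply_eq_sum_univ χ, ← Finset.sum_coe_sort (qPrimes q S),
    ← Equiv.sum_comp e.toEquiv]
  refine Finset.sum_congr rfl fun i _ => ?_
  have h1 : (w (e i).1 : ZMod p) = (l (some i) : ZMod p) := by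
    apply hw
    rw [Ne, ZMod.natCast_eq_zero_iff]
    intro h
    exact hpl (some i) ((Nat.prime_dvd_prime_iff_eq hp (hl (some i))).mp h)
  have h2 := hφl (some i) _ h1
  have h3 : (fun j => if i = j then (1 : ZMod q) else 0) = Pi.single i 1 := by
    funext j
    simp [Pi.single_apply, eq_comm]
  rw [h3, smul_eq_mul]
  change (n.factorization (e i).1 : ZMod q) * Multiplicative.toAdd (φ (w (e i).1)) = _
  rw [h2]
  rfl
end

section
/- Let q be an odd prime, k ≥ 1, and n, ℓ ≥ 1. Let p_1, …, p_n and p̄_1, …, p̄_n be two n-tuples of distinct primes, and let ν_{ij} be natural numbers (1 ≤ i ≤ n, 1 ≤ j ≤ ℓ) such that none of the integers ∏_{i=1}^{n} p_i^{ν_{ij}} is a perfect q-th power. Then the set {∏_{i=1}^{n} p_i^{ν_{ij}} : 1 ≤ j ≤ ℓ} belongs to 𝒯_{k,q} if and only if the set {∏_{i=1}^{n} p̄_i^{ν_{ij}} : 1 ≤ j ≤ ℓ} belongs to 𝒯_{k,q}. -/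
open Finset

section
open scoped ENNReal

lemma sw_eul {ι : Type*} (a : ι → ℝ≥0∞) (F : Finset ι) :
    ∑' m : {m : Multiset ι // ∀ x ∈ m, x ∈ F}, (m.1.map a).prod = ∏ i ∈ F, (1 - a i)⁻¹ := by
  classical
  induction F using Finset.induction_on with
  | empty =>
    have : Unique {m : Multiset ι // ∀ x ∈ m, x ∈ (∅ : Finset ι)} :=
      { default := ⟨0, by simp⟩
        uniq := fun m => Subtype.ext (Multiset.eq_zero_of_forall_notMem fun x hx => by
          simpa using m.2 x hx) }
    rw [tsum_fintype]
    simp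
    have h : (default : {m : Multiset ι // ∀ x ∈ m, x ∈ (∅ : Finset ι)}).1 = 0 :=
      Multiset.eq_zero_of_forall_notMem fun x hx => by
        simpa using (default : {m : Multiset ι // ∀ x ∈ m, x ∈ (∅ : Finset ι)}).2 x hx
    simp [h]
  | insert i F hi ih =>
    rw [Finset.prod_insert hi, ← ih, ← ENNReal.tsum_geometric]
    let e : ℕ × {m : Multiset ι // ∀ x ∈ m, x ∈ F} ≃ {m : Multiset ι // ∀ x ∈ m, x ∈ insert i F} :=
      { toFun := fun y => ⟨Multiset.replicate y.1 i + y.2.1, by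
          intro x hx
          rcases Multiset.mem_add.1 hx with h | h
          · simp [Multiset.eq_of_mem_replicate h]
          · exact Finset.mem_insert_of_mem (y.2.2 x h)⟩
        invFun := fun m => ⟨m.1.count i, ⟨m.1.filter (fun x => x ≠ i), by
          intro x hx
          rw [Multiset.mem_filter] at hx
          exact Finset.mem_of_mem_insert_of_ne (m.2 x hx.1) hx.2⟩⟩
        left_inv := by
          rintro ⟨n, m, hm⟩
          have him : i ∉ m := fun h => hi (hm i h)
          refine Prod.ext ?_ (Subtype.ext ?_)
          · simp [Multiset.count_eq_zero_of_notMem him]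
          · simp only [Multiset.filter_add]
            rw [Multiset.filter_eq_nil.2, zero_add, Multiset.filter_eq_self.2]
            · rintro x hx rfl; exact him hx
            · intro x hx; simpa using Multiset.eq_of_mem_replicate hx
        right_inv := by
          rintro ⟨m, hm⟩
          refine Subtype.ext ?_
          simp only
          rw [← Multiset.filter_eq']
          exact Multiset.filter_add_not _ m }
    rw [← e.tsum_eq, ENNReal.tsum_prod', ← ENNReal.tsum_mul_right]
    congr 1; ext n
    rw [← ENNReal.tsum_mul_left]
    congr 1; ext m
    simp [e]

lemma sw_eul_lower {ι : Type*} (a : ι → ℝ≥0∞) (F : Finset ι) :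
    ∏ i ∈ F, (1 - a i)⁻¹ ≤ ∑' m : Multiset ι, (m.map a).prod := by
  rw [← sw_eul]
  exact ENNReal.tsum_comp_le_tsum_of_injective (Subtype.val_injective) (fun m : Multiset ι => (m.map a).prod)

lemma sw_eul_upper {ι : Type*} (a : ι → ℝ≥0∞) (B : ℝ≥0∞)
    (h : ∀ F : Finset ι, ∏ i ∈ F, (1 - a i)⁻¹ ≤ B) :
    ∑' m : Multiset ι, (m.map a).prod ≤ B := by
  classical
  rw [ENNReal.tsum_eq_iSup_sum]
  refine iSup_le fun s => ?_
  let F : Finset ι := s.biUnion (fun m => m.toFinset)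
  refine le_trans ?_ (h F)
  rw [← sw_eul]
  have hs : ∀ m ∈ s, ∀ x ∈ m, x ∈ F := fun m hm x hx =>
    Finset.mem_biUnion.2 ⟨m, hm, Multiset.mem_toFinset.2 hx⟩
  let g : s ↪ {m : Multiset ι // ∀ x ∈ m, x ∈ F} := ⟨fun m => ⟨m.1, hs m.1 m.2⟩, fun x y hxy => by
    apply Subtype.ext; simpa using hxy⟩
  rw [← Finset.sum_coe_sort]
  have := ENNReal.sum_le_tsum (Finset.univ.map g) (f := fun m => (m.1.map a).prod)
  rw [Finset.sum_map] at this
  exact this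

open UniqueFactorizationMonoid in
/-- nonzero ideals are multisets of primes -/
lemma sw_ideal_sum {R : Type*} [CommRing R] [IsDedekindDomain R] (f : Ideal R →* ℝ≥0∞) :
    ∑' m : Multiset {P : Ideal R // Prime P}, (m.map (fun P => f P.1)).prod
      = ∑' I : {I : Ideal R // I ≠ ⊥}, f I.1 := by
  classical
  let e : Multiset {P : Ideal R // Prime P} → {I : Ideal R // I ≠ ⊥} := fun m =>
    ⟨(m.map Subtype.val).prod, by
      intro h0
      have := Multiset.prod_eq_zero_iff.1 h0
      rw [Multiset.mem_map] at this
      obtain ⟨P, _, hP⟩ := this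
      exact P.2.ne_zero hP⟩
  have he : Function.Bijective e := by
    constructor
    · intro m m' h
      have h1 : (m.map Subtype.val).prod = (m'.map Subtype.val).prod := congrArg Subtype.val h
      have h2 := congrArg normalizedFactors h1
      rw [normalizedFactors_prod_of_prime, normalizedFactors_prod_of_prime] at h2
      · exact Multiset.map_injective Subtype.val_injective h2
      · intro p hp; obtain ⟨P, _, rfl⟩ := Multiset.mem_map.1 hp; exact P.2
      · intro p hp; obtain ⟨P, _, rfl⟩ := Multiset.mem_map.1 hp; exact P.2
    · rintro ⟨I, hI⟩
      refine ⟨(normalizedFactors I).attach.map (fun P => ⟨P.1, prime_of_normalized_factor _ P.2⟩), ?_⟩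
      apply Subtype.ext
      simp only [e, Multiset.map_map, Function.comp_def]
      rw [Multiset.attach_map_val' _ (fun x => x), Multiset.map_id']
      exact associated_iff_eq.1 (prod_normalizedFactors hI)
  rw [← (Equiv.ofBijective e he).tsum_eq]
  congr 1; ext m
  simp only [Equiv.ofBijective_apply, e]
  rw [map_multiset_prod, Multiset.map_map]
  rfl
end

section
open scoped ENNReal
open NumberField Filter Topology

/-- weight N(I)^{-s} -/
noncomputable def sw_wt (K : Type*) [Field K] [NumberField K] (s : ℝ) : Ideal (𝓞 K) →* ℝ≥0∞ where
  toFun I := ENNReal.ofReal ((Ideal.absNorm I : ℝ) ^ (-s))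
  map_one' := by simp
  map_mul' I J := by
    rw [map_mul, Nat.cast_mul, Real.mul_rpow (by positivity) (by positivity),
      ENNReal.ofReal_mul (by positivity)]

/-- sum over nonzero ideals -/
noncomputable def sw_Z (K : Type*) [Field K] [NumberField K] (s : ℝ) : ℝ≥0∞ :=
  ∑' I : {I : Ideal (𝓞 K) // I ≠ ⊥}, sw_wt K s I.1

lemma sw_Z_eq_nat (K : Type*) [Field K] [NumberField K] (s : ℝ) (hs : 1 < s) :
    sw_Z K s = ∑' n : ℕ, ENNReal.ofReal
      ((Nat.card {I : Ideal (𝓞 K) // Ideal.absNorm I = n} : ℝ) * (n : ℝ) ^ (-s)) := by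
  have h1 : sw_Z K s = ∑' I : Ideal (𝓞 K), sw_wt K s I := by
    unfold sw_Z
    refine tsum_subtype_eq_of_support_subset (s := {I : Ideal (𝓞 K) | I ≠ ⊥}) ?_
    intro I hI hI0
    apply hI
    have : I = ⊥ := by simpa using hI0
    subst this
    simp [sw_wt, Real.zero_rpow (by linarith : (-s) ≠ 0)]
  rw [h1, ← (Equiv.sigmaFiberEquiv (fun I : Ideal (𝓞 K) => Ideal.absNorm I)).tsum_eq,
    ENNReal.tsum_sigma']
  congr 1; ext n
  have hfin : Finite {I : Ideal (𝓞 K) // Ideal.absNorm I = n} :=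
    Ideal.finite_setOfPred_absNorm_eq n
  have := Fintype.ofFinite {I : Ideal (𝓞 K) // Ideal.absNorm I = n}
  rw [ENNReal.ofReal_mul (by positivity), ENNReal.ofReal_natCast, Nat.card_eq_fintype_card,
    tsum_fintype]
  rw [Finset.sum_congr rfl (g := fun _ => ENNReal.ofReal ((n : ℝ) ^ (-s)))]
  · simp
  · rintro ⟨I, hI⟩ _
    simp [sw_wt, hI, Equiv.sigmaFiberEquiv]

lemma sw_zeta_eq (K : Type*) [Field K] [NumberField K] :
    ∀ᶠ s : ℝ in 𝓝[>] 1, sw_Z K s ≠ ∞ ∧ dedekindZeta K s = ((sw_Z K s).toReal : ℂ) := by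
  have ht := tendsto_sub_one_mul_dedekindZeta_nhdsGT K
  have hne : (dedekindZeta_residue K : ℂ) ≠ 0 := by
    exact_mod_cast dedekindZeta_residue_ne_zero K
  have h2 := ht.eventually_ne hne
  filter_upwards [h2, self_mem_nhdsWithin] with s hs1 hs
  have hs : 1 < s := hs
  have hz : dedekindZeta K s ≠ 0 := fun h => hs1 (by rw [h, mul_zero])
  set g : ℕ → ℝ := fun n => (Nat.card {I : Ideal (𝓞 K) // Ideal.absNorm I = n} : ℝ) * (n : ℝ) ^ (-s)
    with hg
  have hg0 : ∀ n, 0 ≤ g n := fun n => by positivity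
  have hterm : ∀ n, LSeries.term
      (fun n ↦ (Nat.card {I : Ideal (𝓞 K) // Ideal.absNorm I = n} : ℂ)) s n = (g n : ℂ) := by
    intro n
    rw [LSeries.term_def]
    split_ifs with h
    · subst h; simp [hg, Real.zero_rpow (by linarith : (-s) ≠ 0)]
    · simp only [hg]
      rw [Real.rpow_neg (by positivity)]
      push_cast
      rw [Complex.ofReal_cpow (by positivity)]
      simp [div_eq_mul_inv]
  have hd : dedekindZeta K s = ∑' n, (g n : ℂ) := by
    unfold dedekindZeta LSeries
    exact tsum_congr hterm
  have hsum : Summable (fun n => (g n : ℂ)) := by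
    by_contra h
    exact hz (by rw [hd, tsum_eq_zero_of_not_summable h])
  have hsum' : Summable g := Complex.summable_ofReal.1 hsum
  have hZ : sw_Z K s = ENNReal.ofReal (∑' n, g n) := by
    rw [sw_Z_eq_nat K s hs, ENNReal.ofReal_tsum_of_nonneg hg0 hsum']
  refine ⟨by rw [hZ]; exact ENNReal.ofReal_ne_top, ?_⟩
  rw [hd, hZ, ENNReal.toReal_ofReal (tsum_nonneg hg0), Complex.ofReal_tsum]

lemma sw_Z_tendsto (K : Type*) [Field K] [NumberField K] :
    ∃ r : ℝ, 0 < r ∧ Tendsto (fun s : ℝ => (s - 1) * (sw_Z K s).toReal) (𝓝[>] 1) (𝓝 r) := by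
  refine ⟨dedekindZeta_residue K, dedekindZeta_residue_pos K, ?_⟩
  have ht := tendsto_sub_one_mul_dedekindZeta_nhdsGT K
  have h3 := (Complex.continuous_re.tendsto _).comp ht
  simp only [Complex.ofReal_re] at h3
  refine h3.congr' ?_
  filter_upwards [sw_zeta_eq K] with s hs
  simp only [Function.comp_apply, hs.2]
  rw [← Complex.ofReal_one, ← Complex.ofReal_sub, ← Complex.ofReal_mul, Complex.ofReal_re]

/-- No inequality `Z_E² ≤ C Z_L` near 1. -/
lemma sw_no_square (E L : Type*) [Field E] [NumberField E] [Field L] [NumberField L]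
    (C : ℝ≥0∞) (hC : C ≠ ∞) (h : ∀ s : ℝ, 1 < s → sw_Z E s ^ 2 ≤ C * sw_Z L s) : False := by
  obtain ⟨r, hr, htE⟩ := sw_Z_tendsto E
  obtain ⟨r', hr', htL⟩ := sw_Z_tendsto L
  have h0 : Tendsto (fun s : ℝ => s - 1) (𝓝[>] 1) (𝓝 0) := by
    have : Tendsto (fun s : ℝ => s - 1) (𝓝 1) (𝓝 (1 - 1)) := by
      exact (continuous_id.sub continuous_const).tendsto 1
    rw [sub_self] at this
    exact this.mono_left nhdsWithin_le_nhds
  have h1 : Tendsto (fun s : ℝ => C.toReal * ((s - 1) * ((s - 1) * (sw_Z L s).toReal))) (𝓝[>] 1)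
      (𝓝 (C.toReal * (0 * r'))) := (h0.mul htL).const_mul _
  have h2 := htE.pow 2
  have h3 : r ^ 2 ≤ C.toReal * (0 * r') := by
    refine le_of_tendsto_of_tendsto h2 h1 ?_
    filter_upwards [sw_zeta_eq L, self_mem_nhdsWithin] with s hs hs1
    have hs1 : 1 < s := hs1
    have := ENNReal.toReal_mono (ENNReal.mul_ne_top hC hs.1) (h s hs1)
    rw [ENNReal.toReal_pow, ENNReal.toReal_mul] at this
    have h5 : 0 ≤ (s - 1) ^ 2 := sq_nonneg _
    nlinarith [mul_le_mul_of_nonneg_left this h5]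
  have : 0 < r ^ 2 := by positivity
  simp at h3
  nlinarith
end

section
open scoped ENNReal
open NumberField Filter Topology

section
variable {K : Type*} [Field K] [NumberField K]

lemma sw_norm_span (p : ℕ) : Ideal.absNorm (Ideal.span {(p : 𝓞 K)}) = p ^ Module.finrank ℚ K := by
  rw [Ideal.absNorm_span_singleton]
  have := Algebra.norm_algebraMap (R := ℤ) (S := 𝓞 K) (p : ℤ)
  rw [map_natCast] at this
  rw [this, RingOfIntegers.rank]
  simp [Int.natAbs_pow]

/-- the prime below -/
lemma sw_prime_below (P : Ideal (𝓞 K)) (hP : Prime P) :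
    (Ideal.absNorm P).minFac.Prime ∧ ((Ideal.absNorm P).minFac : 𝓞 K) ∈ P ∧
    1 < Ideal.absNorm P := by
  have hPp : P.IsPrime := Ideal.isPrime_of_prime hP
  have hn1 : Ideal.absNorm P ≠ 1 := by
    rw [Ne, Ideal.absNorm_eq_one_iff]; exact hPp.ne_top
  have hn0 : Ideal.absNorm P ≠ 0 := by
    rw [Ne, Ideal.absNorm_eq_zero_iff]; exact hP.ne_zero
  have hmem : (Ideal.absNorm P : 𝓞 K) ∈ P := Ideal.absNorm_mem P
  have key : ∃ p : ℕ, p.Prime ∧ (p : 𝓞 K) ∈ P := by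
    by_contra hcon
    push Not at hcon
    have : ∀ n : ℕ, n ≠ 0 → (n : 𝓞 K) ∉ P := by
      intro n
      induction n using Nat.recOnMul with
      | zero => simp
      | one => intro _ h; exact hPp.ne_top ((Ideal.eq_top_iff_one _).2 (by simpa using h))
      | prime p hp => exact fun _ => hcon p hp
      | mul a b ha hb =>
        intro hab h
        rw [Nat.cast_mul] at h
        rcases hPp.mem_or_mem h with h | h
        · exact ha (by rintro rfl; simp at hab) h
        · exact hb (by rintro rfl; simp at hab) h
    exact this _ hn0 hmem
  obtain ⟨p, hp, hpP⟩ := key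
  have hdvd : Ideal.absNorm P ∣ p ^ Module.finrank ℚ K := by
    rw [← sw_norm_span (K := K) p]
    exact Ideal.absNorm_dvd_absNorm_of_le ((Ideal.span_singleton_le_iff_mem _).2 hpP)
  have hmf : (Ideal.absNorm P).minFac = p := by
    have h1 := Nat.minFac_prime hn1
    exact (Nat.prime_dvd_prime_iff_eq h1 hp).1 (h1.dvd_of_dvd_pow ((Nat.minFac_dvd _).trans hdvd))
  rw [hmf]
  exact ⟨hp, hpP, by omega⟩

lemma sw_fiber_card (p : ℕ) (T : Finset {P : Ideal (𝓞 K) // Prime P})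
    (hT : ∀ P ∈ T, (Ideal.absNorm P.1).minFac = p) : T.card ≤ Module.finrank ℚ K := by
  classical
  rcases T.eq_empty_or_nonempty with rfl | ⟨P0, hP0⟩
  · simp
  have hp : p.Prime := by
    rw [← hT P0 hP0]; exact (sw_prime_below P0.1 P0.2).1
  have hdvd : ∏ P ∈ T, P.1 ∣ Ideal.span {(p : 𝓞 K)} := by
    have := Finset.prod_primes_dvd (s := T.map (Function.Embedding.subtype _))
      (Ideal.span {(p : 𝓞 K)}) ?_ ?_
    · rwa [Finset.prod_map] at this
    · intro a ha
      obtain ⟨P, _, rfl⟩ := Finset.mem_map.1 ha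
      exact P.2
    · intro a ha
      obtain ⟨P, hP, rfl⟩ := Finset.mem_map.1 ha
      refine Ideal.dvd_iff_le.2 ((Ideal.span_singleton_le_iff_mem _).2 ?_)
      rw [← hT P hP]
      exact (sw_prime_below P.1 P.2).2.1
  have h1 : Ideal.absNorm (∏ P ∈ T, P.1) ∣ p ^ Module.finrank ℚ K := by
    rw [← sw_norm_span (K := K) p]
    exact Ideal.absNorm_dvd_absNorm_of_le (Ideal.le_of_dvd hdvd)
  have h2 := Nat.le_of_dvd (pow_pos hp.pos _) h1
  rw [map_prod] at h2
  have h3 : p ^ T.card ≤ ∏ P ∈ T, Ideal.absNorm P.1 := by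
    rw [← Finset.prod_const]
    refine Finset.prod_le_prod' fun P hP => ?_
    rw [← hT P hP]
    exact Nat.minFac_le (by have := (sw_prime_below P.1 P.2).2.2; omega)
  exact (Nat.pow_le_pow_iff_right hp.one_lt).1 (h3.trans h2)

lemma sw_nonprime_sum : ∑' P : {P : Ideal (𝓞 K) // Prime P},
    (if (Ideal.absNorm P.1).Prime then 0 else ENNReal.ofReal ((Ideal.absNorm P.1 : ℝ)⁻¹)) ≠ ∞ := by
  classical
  set h : ℕ → ℝ≥0∞ := fun p => ENNReal.ofReal (((p : ℝ) ^ 2)⁻¹) with hh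
  have hle : ∑' P : {P : Ideal (𝓞 K) // Prime P},
      (if (Ideal.absNorm P.1).Prime then 0 else ENNReal.ofReal ((Ideal.absNorm P.1 : ℝ)⁻¹)) ≤
      ∑' P : {P : Ideal (𝓞 K) // Prime P}, h (Ideal.absNorm P.1).minFac := by
    refine ENNReal.tsum_le_tsum fun P => ?_
    split_ifs with hP
    · exact zero_le
    · have hb := sw_prime_below P.1 P.2
      refine ENNReal.ofReal_le_ofReal ?_
      have h1 := Nat.minFac_sq_le_self (n := Ideal.absNorm P.1) (by omega) hP
      have h2 : 0 < (Ideal.absNorm P.1).minFac := hb.1.pos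
      refine inv_anti₀ (by positivity) ?_
      exact_mod_cast h1
  refine ne_top_of_le_ne_top ?_ hle
  rw [← (Equiv.sigmaFiberEquiv
    (fun P : {P : Ideal (𝓞 K) // Prime P} => (Ideal.absNorm P.1).minFac)).tsum_eq,
    ENNReal.tsum_sigma']
  have hle2 : ∀ p : ℕ, ∑' P : {P : {P : Ideal (𝓞 K) // Prime P} // (Ideal.absNorm P.1).minFac = p},
      h (Ideal.absNorm ((Equiv.sigmaFiberEquiv
    (fun P : {P : Ideal (𝓞 K) // Prime P} => (Ideal.absNorm P.1).minFac)) ⟨p, P⟩).1).minFac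
      ≤ (Module.finrank ℚ K : ℝ≥0∞) * h p := by
    intro p
    rw [ENNReal.tsum_eq_iSup_sum]
    refine iSup_le fun T => ?_
    rw [Finset.sum_congr rfl (g := fun _ => h p)]
    · rw [Finset.sum_const, nsmul_eq_mul]
      gcongr
      rw [← Finset.card_map (Function.Embedding.subtype _)]
      refine sw_fiber_card (K := K) p _ ?_
      intro P hP
      obtain ⟨P', _, rfl⟩ := Finset.mem_map.1 hP
      exact P'.2
    · rintro ⟨P, hP⟩ _
      simp [Equiv.sigmaFiberEquiv, hP]
  refine ne_top_of_le_ne_top ?_ (ENNReal.tsum_le_tsum hle2)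
  rw [ENNReal.tsum_mul_left]
  refine ENNReal.mul_ne_top (ENNReal.natCast_ne_top _) ?_
  have hs : Summable (fun p : ℕ => ((p : ℝ) ^ 2)⁻¹) := Real.summable_nat_pow_inv.2 (by norm_num)
  rw [hh, ← ENNReal.ofReal_tsum_of_nonneg (fun p => by positivity) hs]
  exact ENNReal.ofReal_ne_top

lemma sw_factor_le (s : ℝ) (hs : 1 < s) (P : Ideal (𝓞 K)) (hP : Prime P) :
    (1 - sw_wt K s P)⁻¹ ≤ ENNReal.ofReal (Real.exp (2 * (Ideal.absNorm P : ℝ)⁻¹)) := by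
  have hb := (sw_prime_below P hP).2.2
  have hb2 : (2 : ℝ) ≤ (Ideal.absNorm P : ℝ) := by exact_mod_cast hb
  set N : ℝ := (Ideal.absNorm P : ℝ) with hN
  have hu : N⁻¹ ≤ 1 / 2 := by
    rw [one_div]; exact inv_anti₀ (by norm_num) hb2
  have ht : N ^ (-s) ≤ N⁻¹ := by
    rw [← Real.rpow_neg_one]
    exact Real.rpow_le_rpow_of_exponent_le (by linarith) (by linarith)
  have ht0 : 0 < N⁻¹ := by positivity
  have : sw_wt K s P = ENNReal.ofReal (N ^ (-s)) := rfl
  rw [this, ← ENNReal.ofReal_one, ← ENNReal.ofReal_sub _ (by positivity),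
    ← ENNReal.ofReal_inv_of_pos (by linarith)]
  refine ENNReal.ofReal_le_ofReal ?_
  have h1 : (1 - N ^ (-s))⁻¹ ≤ (1 - N⁻¹)⁻¹ := inv_anti₀ (by linarith) (by linarith)
  have h2 : (1 - N⁻¹)⁻¹ ≤ 1 + 2 * N⁻¹ := by
    rw [inv_le_iff_one_le_mul₀ (by linarith)]
    nlinarith
  have h3 := Real.add_one_le_exp (2 * N⁻¹)
  linarith

lemma sw_bad_bound (B : Set (Ideal (𝓞 K))) (hB : B.Finite) :
    ∃ C : ℝ≥0∞, C ≠ ∞ ∧ ∀ s : ℝ, 1 < s → ∀ F : Finset {P : Ideal (𝓞 K) // Prime P},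
      (∀ P ∈ F, P.1 ∈ B ∨ ¬ (Ideal.absNorm P.1).Prime) →
      ∏ P ∈ F, (1 - sw_wt K s P.1)⁻¹ ≤ C := by
  classical
  set S := ∑' P : {P : Ideal (𝓞 K) // Prime P},
    (if (Ideal.absNorm P.1).Prime then 0 else ENNReal.ofReal ((Ideal.absNorm P.1 : ℝ)⁻¹)) with hS
  have hS' : S ≠ ∞ := sw_nonprime_sum (K := K)
  refine ⟨ENNReal.ofReal (Real.exp (2 * (S.toReal + hB.toFinset.card))), ENNReal.ofReal_ne_top, ?_⟩
  intro s hs F hF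
  calc ∏ P ∈ F, (1 - sw_wt K s P.1)⁻¹
      ≤ ∏ P ∈ F, ENNReal.ofReal (Real.exp (2 * (Ideal.absNorm P.1 : ℝ)⁻¹)) :=
        Finset.prod_le_prod' fun P _ => sw_factor_le s hs P.1 P.2
    _ = ENNReal.ofReal (Real.exp (2 * ∑ P ∈ F, (Ideal.absNorm P.1 : ℝ)⁻¹)) := by
        rw [← ENNReal.ofReal_prod_of_nonneg (fun _ _ => (Real.exp_pos _).le), ← Real.exp_sum,
          Finset.mul_sum]
    _ ≤ _ := by
        refine ENNReal.ofReal_le_ofReal (Real.exp_le_exp.2 ?_)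
        refine mul_le_mul_of_nonneg_left ?_ (by norm_num)
        rw [← Finset.sum_filter_add_sum_filter_not F
          (fun P => ¬ (Ideal.absNorm P.1).Prime)]
        refine add_le_add ?_ ?_
        · refine (ENNReal.ofReal_le_iff_le_toReal hS').1 ?_
          rw [ENNReal.ofReal_sum_of_nonneg (fun _ _ => by positivity)]
          refine le_trans (le_of_eq ?_) (ENNReal.sum_le_tsum (F.filter
            (fun P => ¬ (Ideal.absNorm P.1).Prime)))
          refine Finset.sum_congr rfl fun P hP => ?_
          rw [if_neg (Finset.mem_filter.1 hP).2]
        · refine le_trans (Finset.sum_le_card_nsmul _ _ 1 ?_) ?_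
          · intro P hP
            have hb := (sw_prime_below P.1 P.2).2.2
            refine inv_le_one_of_one_le₀ ?_
            exact_mod_cast hb.le
          · rw [nsmul_eq_mul, mul_one]
            rw [← Finset.card_map (Function.Embedding.subtype _)]
            norm_cast
            refine Finset.card_le_card ?_
            intro P hP
            obtain ⟨P', hP', rfl⟩ := Finset.mem_map.1 hP
            rw [Finset.mem_filter, not_not] at hP'
            simpa using (hF P' hP'.1).resolve_right (by simpa using hP'.2)
end

theorem sw_analytic (E L : Type*) [Field E] [NumberField E] [Field L] [NumberField L]
    (φ : 𝓞 E →+* 𝓞 L) (B : Set (Ideal (𝓞 E))) (hB : B.Finite)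
    (h : ∀ P : Ideal (𝓞 E), Prime P → P ∉ B → (Ideal.absNorm P).Prime →
      ∃ Q₁ Q₂ : Ideal (𝓞 L), Prime Q₁ ∧ Prime Q₂ ∧ Q₁ ≠ Q₂ ∧ Q₁.comap φ = P ∧ Q₂.comap φ = P ∧
        Ideal.absNorm Q₁ = Ideal.absNorm P ∧ Ideal.absNorm Q₂ = Ideal.absNorm P) : False := by
  classical
  obtain ⟨C, hC, hbad⟩ := sw_bad_bound B hB
  choose Q₁ Q₂ hQ₁ hQ₂ hne hc₁ hc₂ hn₁ hn₂ using h
  let good : {P : Ideal (𝓞 E) // Prime P} → Prop := fun P => P.1 ∉ B ∧ (Ideal.absNorm P.1).Prime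
  let g : {P // good P} × Bool → {Q : Ideal (𝓞 L) // Prime Q} := fun x =>
    if x.2 then ⟨_, hQ₁ x.1.1.1 x.1.1.2 x.1.2.1 x.1.2.2⟩
    else ⟨_, hQ₂ x.1.1.1 x.1.1.2 x.1.2.1 x.1.2.2⟩
  have hgc : ∀ x, (g x).1.comap φ = x.1.1.1 := by
    rintro ⟨P, b⟩
    cases b
    · exact hc₂ _ _ _ _
    · exact hc₁ _ _ _ _
  have hgn : ∀ x, Ideal.absNorm (g x).1 = Ideal.absNorm x.1.1.1 := by
    rintro ⟨P, b⟩
    cases b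
    · exact hn₂ _ _ _ _
    · exact hn₁ _ _ _ _
  have hginj : Function.Injective g := by
    rintro ⟨P, b⟩ ⟨P', b'⟩ hx
    have h1 : P = P' := by
      apply Subtype.ext; apply Subtype.ext
      have := hgc ⟨P, b⟩
      rw [hx, hgc] at this
      exact this.symm
    subst h1
    have h2 := congrArg Subtype.val hx
    cases b <;> cases b'
    · rfl
    · exact absurd h2.symm (hne _ _ _ _)
    · exact absurd h2 (hne _ _ _ _)
    · rfl
  refine sw_no_square E L (C ^ 2) (by finiteness) fun s hs => ?_
  have hgood : ∀ G : Finset {P // good P},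
      (∏ P ∈ G, (1 - sw_wt E s P.1.1)⁻¹) ^ 2 ≤ sw_Z L s := by
    intro G
    have h1 := sw_eul_lower (fun Q : {Q : Ideal (𝓞 L) // Prime Q} => sw_wt L s Q.1)
      ((G ×ˢ (Finset.univ : Finset Bool)).map ⟨g, hginj⟩)
    rw [sw_ideal_sum (sw_wt L s)] at h1
    refine le_trans (le_of_eq ?_) h1
    rw [Finset.prod_map, Finset.prod_product, ← Finset.prod_pow]
    refine Finset.prod_congr rfl fun P _ => ?_
    have h3 : ∀ b : Bool, sw_wt L s (g (P, b)).1 = sw_wt E s P.1.1 := by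
      intro b
      change ENNReal.ofReal _ = ENNReal.ofReal _
      rw [hgn]
    simp only [Function.Embedding.coeFn_mk, h3]
    simp
  have hZE : sw_Z E s ^ 2 ≤ C ^ 2 * sw_Z L s := by
    have hsup : ∀ F : Finset {P : Ideal (𝓞 E) // Prime P},
        ∏ P ∈ F, (1 - sw_wt E s P.1)⁻¹ ≤ C * (sw_Z L s) ^ (2⁻¹ : ℝ) := by
      intro F
      rw [← Finset.prod_filter_mul_prod_filter_not F good, mul_comm]
      refine mul_le_mul' (hbad s hs _ ?_) ?_
      · intro P hP
        have := (Finset.mem_filter.1 hP).2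
        simp only [good, not_and_or, not_not] at this
        exact this
      · have h4 := hgood (F.subtype good)
        have h6 := Finset.prod_subtype_eq_prod_filter (s := F) (p := good)
          (fun P : {P : Ideal (𝓞 E) // Prime P} => (1 - sw_wt E s P.1)⁻¹)
        rw [h6] at h4
        rw [ENNReal.le_rpow_inv_iff (by norm_num)]
        rw [← ENNReal.rpow_natCast] at h4
        exact_mod_cast h4
    have h5 := sw_eul_upper (fun Q : {Q : Ideal (𝓞 E) // Prime Q} => sw_wt E s Q.1) _ hsup
    rw [sw_ideal_sum (sw_wt E s)] at h5
    calc sw_Z E s ^ 2 ≤ (C * (sw_Z L s) ^ (2⁻¹ : ℝ)) ^ 2 := by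
          gcongr
          exact h5
      _ = C ^ 2 * sw_Z L s := by
          rw [mul_pow]
          congr 1
          rw [← ENNReal.rpow_natCast, ← ENNReal.rpow_mul]
          norm_num
  exact hZE
end

section
open NumberField Polynomial

theorem sw_kummer_aux (E L : Type) [Field E] [NumberField E] [Field L] [NumberField L]
    [Algebra E L] (q : ℕ) (hq : q.Prime) (b : ℕ) (hb : b ≠ 0) (ζ : 𝓞 E)
    (hζ : IsPrimitiveRoot ζ q) (α : 𝓞 L) (hα : α ^ q = b) (σ : L ≃ₐ[E] L)
    (hσ : σ (α : L) = algebraMap E L ζ * α)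
    (pb : PowerBasis E L) (hpb : pb.gen = (α : L)) (M : ℕ) (hM : M ≠ 0) :
    ∃ P : Ideal (𝓞 E), Prime P ∧ (Ideal.absNorm P).Prime ∧ (M : 𝓞 E) ∉ P ∧
      ¬ ∃ x : 𝓞 E, x ^ q - (b : 𝓞 E) ∈ P := by
  by_contra hcon
  push Not at hcon
  have hαint : IsIntegral (𝓞 E) pb.gen := by
    rw [hpb]
    exact (RingOfIntegers.isIntegral_coe α).tower_top
  have hdint : IsIntegral (𝓞 E) (Algebra.discr E pb.basis) :=
    Algebra.discr_isIntegral _ fun i => by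
      rw [pb.basis_eq_pow]; exact hαint.pow _
  obtain ⟨d, hd⟩ := (IsIntegrallyClosed.isIntegral_iff (R := 𝓞 E) (K := E)).1 hdint
  have hd0 : d ≠ 0 := by
    rintro rfl
    rw [map_zero] at hd
    exact Algebra.discr_not_zero_of_basis E pb.basis hd.symm
  have hadj : ∀ z : 𝓞 L, algebraMap (𝓞 E) (𝓞 L) d * z ∈ Algebra.adjoin (𝓞 E) {α} := by
    intro z
    have h1 := Algebra.discr_mul_isIntegral_mem_adjoin (R := 𝓞 E) E hαint (z := (z : L))
      ((RingOfIntegers.isIntegral_coe z).tower_top)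
    have h2 : (Algebra.adjoin (𝓞 E) {α}).map (IsScalarTower.toAlgHom (𝓞 E) (𝓞 L) L)
        = Algebra.adjoin (𝓞 E) {pb.gen} := by
      rw [AlgHom.map_adjoin, hpb]; simp
    rw [← h2] at h1
    obtain ⟨y, hy, hyz⟩ := Subalgebra.mem_map.1 h1
    have : y = algebraMap (𝓞 E) (𝓞 L) d * z := by
      apply RingOfIntegers.coe_injective
      rw [← hd] at hyz
      rw [map_mul]
      rw [← IsScalarTower.algebraMap_apply]
      rw [Algebra.smul_def] at hyz
      rw [← IsScalarTower.algebraMap_apply] at hyz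
      exact hyz
    rwa [← this]
  have hfac : (M * q * b : 𝓞 E) * d ≠ 0 := by
    have : ((M * q * b : ℕ) : 𝓞 E) ≠ 0 := by
      exact_mod_cast (by simp [hM, hb, hq.ne_zero] : M * q * b ≠ 0)
    push_cast at this
    exact mul_ne_zero this hd0
  set f := (M * q * b : 𝓞 E) * d with hf
  refine sw_analytic E L (algebraMap (𝓞 E) (𝓞 L)) {P | P.IsPrime ∧ P ≠ ⊥ ∧ f ∈ P} ?_ ?_
  · have h1 : (Ideal.span {f}) ≠ 0 := by simpa using hfac
    refine ((Ideal.finite_factors h1).image (fun v => v.asIdeal)).subset ?_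
    rintro P ⟨hP, hP0, hfP⟩
    refine ⟨⟨P, hP, hP0⟩, ?_, rfl⟩
    simpa [Ideal.dvd_span_singleton] using hfP
  intro P hP hPB hPn
  have hPp : P.IsPrime := Ideal.isPrime_of_prime hP
  have hP0 : P ≠ ⊥ := hP.ne_zero
  have hfP : f ∉ P := fun h => hPB ⟨hPp, hP0, h⟩
  have hMP : (M : 𝓞 E) ∉ P := fun h => hfP (by
    rw [hf, mul_assoc, mul_assoc]; exact P.mul_mem_right _ h)
  have hdP : d ∉ P := fun h => hfP (P.mul_mem_left _ h)
  have hqbP : (q * b : 𝓞 E) ∉ P := fun h => hfP (by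
    rw [hf, mul_assoc _ (q : 𝓞 E)]; exact P.mul_mem_right _ (P.mul_mem_left _ h))
  obtain ⟨x, hx⟩ := hcon P hP hPn hMP
  have hPm : P.IsMaximal := hPp.isMaximal hP0
  obtain ⟨Q, hQm, hQP⟩ := Ideal.exists_ideal_over_maximal_of_isIntegral (S := 𝓞 L) P (by
    rw [(RingHom.injective_iff_ker_eq_bot _).1 (FaithfulSMul.algebraMap_injective (𝓞 E) (𝓞 L))]
    exact bot_le)
  have hmem : ∀ y : 𝓞 E, algebraMap (𝓞 E) (𝓞 L) y ∈ Q ↔ y ∈ P := by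
    intro y; rw [← hQP, Ideal.mem_comap]
  have hQ0 : Q ≠ ⊥ := by
    rintro rfl
    apply hP0
    rw [eq_bot_iff]
    intro y hy
    have := (hmem y).2 hy
    simpa using this
  have hζL : IsPrimitiveRoot (algebraMap (𝓞 E) (𝓞 L) ζ) q :=
    hζ.map_of_injective (FaithfulSMul.algebraMap_injective (𝓞 E) (𝓞 L))
  -- α is congruent to an element of the base
  have ht : ∃ t : 𝓞 E, α - algebraMap (𝓞 E) (𝓞 L) t ∈ Q := by
    have h1 : α ^ q - (algebraMap (𝓞 E) (𝓞 L) x) ^ q ∈ Q := by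
      have := Q.neg_mem ((hmem _).2 hx)
      rw [map_sub, map_pow, map_natCast] at this
      rw [hα]; simpa using this
    rw [hζL.pow_sub_pow_eq_prod_sub_mul _ _ hq.pos] at h1
    obtain ⟨η, hη, hηQ⟩ := (Ideal.IsPrime.prod_mem_iff (p := Q)).1 h1
    rw [Polynomial.mem_nthRootsFinset hq.pos] at hη
    have : NeZero q := ⟨hq.ne_zero⟩
    obtain ⟨i, -, rfl⟩ := hζL.eq_pow_of_pow_eq_one hη
    exact ⟨ζ ^ i * x, by simpa using hηQ⟩
  obtain ⟨t, ht⟩ := ht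
  have hall : ∀ z : 𝓞 L, ∃ u : 𝓞 E, z - algebraMap (𝓞 E) (𝓞 L) u ∈ Q := by
    have hS : Algebra.adjoin (𝓞 E) {α} ≤
        (⊥ : Subalgebra (𝓞 E) (𝓞 L ⧸ Q)).comap (Ideal.Quotient.mkₐ (𝓞 E) Q) := by
      rw [Algebra.adjoin_le_iff, Set.singleton_subset_iff]
      refine Algebra.mem_bot.2 ⟨t, ?_⟩
      exact ((Ideal.Quotient.eq (I := Q)).2 ht).symm
    intro z
    obtain ⟨u, hu⟩ := Algebra.mem_bot.1 (hS (hadj z))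
    have hu' : algebraMap (𝓞 E) (𝓞 L) d * z - algebraMap (𝓞 E) (𝓞 L) u ∈ Q :=
      (Ideal.Quotient.eq (I := Q)).1 hu.symm
    obtain ⟨e, i, hi, he⟩ := hPm.exists_inv hdP
    refine ⟨e * u, ?_⟩
    have h3 : z - algebraMap (𝓞 E) (𝓞 L) (e * u) = algebraMap (𝓞 E) (𝓞 L) e *
        (algebraMap (𝓞 E) (𝓞 L) d * z - algebraMap (𝓞 E) (𝓞 L) u) +
        algebraMap (𝓞 E) (𝓞 L) i * z := by
      have := congrArg (algebraMap (𝓞 E) (𝓞 L)) he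
      simp only [map_add, map_mul, map_one] at this ⊢
      linear_combination (-z) * this
    rw [h3]
    exact Q.add_mem (Q.mul_mem_left _ hu') (Q.mul_mem_right _ ((hmem i).2 hi))
  have hnorm : Ideal.absNorm Q = Ideal.absNorm P := by
    rw [Ideal.absNorm_apply, Ideal.absNorm_apply, Submodule.cardQuot_apply,
      Submodule.cardQuot_apply]
    symm
    refine Nat.card_congr (Equiv.ofBijective
      (Ideal.quotientMap (I := P) Q (algebraMap (𝓞 E) (𝓞 L)) hQP.ge) ⟨?_, ?_⟩)
    · exact Ideal.quotientMap_injective' hQP.le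
    · intro z
      obtain ⟨z, rfl⟩ := Ideal.Quotient.mk_surjective z
      obtain ⟨u, hu⟩ := hall z
      refine ⟨Ideal.Quotient.mk _ u, ?_⟩
      rw [Ideal.quotientMap_mk]
      exact ((Ideal.Quotient.eq (I := Q)).2 hu).symm
  let τ : 𝓞 L ≃ₐ[𝓞 E] 𝓞 L := RingOfIntegers.mapAlgEquiv σ
  have hτα : τ α = algebraMap (𝓞 E) (𝓞 L) ζ * α := by
    apply RingOfIntegers.coe_injective
    rw [map_mul]
    exact hσ
  have hcc : (Q.comap τ).comap (algebraMap (𝓞 E) (𝓞 L)) = P := by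
    ext y
    rw [Ideal.mem_comap, Ideal.mem_comap, AlgEquiv.commutes, hmem]
  have hQ2p : (Q.comap τ).IsPrime := Ideal.IsPrime.comap _
  refine ⟨Q, Q.comap τ, Ideal.prime_of_isPrime hQ0 hQm.isPrime, ?_, ?_, hQP, hcc, hnorm, ?_⟩
  · refine Ideal.prime_of_isPrime ?_ hQ2p
    intro h0
    apply hP0
    rw [← hcc, h0]
    exact (RingHom.injective_iff_ker_eq_bot _).1 (FaithfulSMul.algebraMap_injective (𝓞 E) (𝓞 L))
  · intro heq
    have h1 : α - algebraMap (𝓞 E) (𝓞 L) t ∈ Q.comap τ := heq ▸ ht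
    rw [Ideal.mem_comap, map_sub, AlgEquiv.commutes, hτα] at h1
    have h2 : (1 - algebraMap (𝓞 E) (𝓞 L) ζ) * α ∈ Q := by
      have := Q.sub_mem ht h1
      convert this using 1
      ring
    apply hqbP
    rw [← hmem]
    rcases hQm.isPrime.mem_or_mem h2 with h3 | h3
    · rw [map_mul]
      apply Q.mul_mem_right
      obtain ⟨m, rfl⟩ : ∃ m, q = m + 1 := ⟨q - 1, by have := hq.pos; omega⟩
      have h4 := hζL.prod_one_sub_pow_eq_order
      rw [map_natCast]
      push_cast
      rw [← h4]
      refine (Ideal.IsPrime.prod_mem_iff (p := Q)).2 ⟨0, ?_, by simpa using h3⟩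
      have := hq.two_le
      exact Finset.mem_range.2 (by omega)
    · rw [map_mul]
      apply Q.mul_mem_left
      rw [map_natCast, ← hα]
      exact Ideal.pow_mem_of_mem _ h3 _ hq.pos
  · rw [← hnorm]
    rw [Ideal.absNorm_apply, Ideal.absNorm_apply, Submodule.cardQuot_apply,
      Submodule.cardQuot_apply]
    refine Nat.card_congr (Ideal.quotientEquiv (Q.comap τ) Q τ.toRingEquiv ?_).toEquiv
    exact (Ideal.map_comap_of_surjective τ.toRingEquiv τ.surjective Q).symm

theorem sw_kummer (E : Type) [Field E] [NumberField E] (q : ℕ) (hq : q.Prime) (b : ℕ)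
    (hb : b ≠ 0) (ζ : E) (hζ : IsPrimitiveRoot ζ q) (hbq : ∀ c : E, c ^ q ≠ b)
    (M : ℕ) (hM : M ≠ 0) :
    ∃ P : Ideal (𝓞 E), Prime P ∧ (Ideal.absNorm P).Prime ∧ (M : 𝓞 E) ∉ P ∧
      ¬ ∃ x : 𝓞 E, x ^ q - (b : 𝓞 E) ∈ P := by
  have hirr : Irreducible (X ^ q - C (b : E)) := X_pow_sub_C_irreducible_of_prime hq hbq
  have : Fact (Irreducible (X ^ q - C (b : E))) := ⟨hirr⟩
  have : NeZero q := ⟨hq.ne_zero⟩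
  let L := AdjoinRoot (X ^ q - C (b : E))
  let pb : PowerBasis E L := AdjoinRoot.powerBasis hirr.ne_zero
  have : FiniteDimensional E L := pb.finite
  have : CharZero L := charZero_of_injective_algebraMap (algebraMap E L).injective
  have : FiniteDimensional ℚ L := Module.Finite.trans E L
  have : NumberField L := {}
  have hroot : (AdjoinRoot.root (X ^ q - C (b : E)) : L) ^ q = (b : L) := by
    have := AdjoinRoot.eval₂_root (X ^ q - C (b : E))
    rw [eval₂_sub, eval₂_X_pow, eval₂_C] at this
    exact (sub_eq_zero.1 this).trans (map_natCast _ _)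
  have hintg : IsIntegral ℤ (AdjoinRoot.root (X ^ q - C (b : E)) : L) := by
    refine IsIntegral.of_pow hq.pos ?_
    rw [hroot]
    have h := isIntegral_algebraMap (R := ℤ) (A := L) (x := (b : ℤ))
    simpa using h
  have hζi : IsIntegral ℤ ζ := hζ.isIntegral hq.pos
  let η : rootsOfUnity q E := hζ.toRootsOfUnity
  refine sw_kummer_aux E L q hq b hb ⟨ζ, hζi⟩ ?_ ⟨AdjoinRoot.root _, hintg⟩ ?_
    (autAdjoinRootXPowSubC q (b : E) η) ?_ pb rfl M hM
  · exact IsPrimitiveRoot.of_map_of_injective (f := algebraMap (𝓞 E) E) hζ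
      RingOfIntegers.coe_injective
  · apply RingOfIntegers.coe_injective
    refine (map_pow (algebraMap (𝓞 L) L) _ _).trans (hroot.trans ?_)
    exact (map_natCast (algebraMap (𝓞 L) L) b).symm
  · have := autAdjoinRootXPowSubC_root (b : E) η
    rw [Algebra.smul_def] at this
    exact this
end

section
open IntermediateField

theorem sw_step {F Ω : Type*} [Field F] [Field Ω] [Algebra F Ω] [IsGalois F Ω] (q : ℕ)
    (hq : q.Prime) (ζ : F) (hζ : IsPrimitiveRoot ζ q) (r γ : Ω) (hr0 : r ≠ 0)
    (hr : ∃ a : F, algebraMap F Ω a = r ^ q) (hγ : γ ∈ F⟮r⟯)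
    (hγq : ∃ a : F, algebraMap F Ω a = γ ^ q) :
    ∃ (j : ℕ) (c : F), γ = algebraMap F Ω c * r ^ j := by
  have : NeZero q := ⟨hq.ne_zero⟩
  by_cases hγ0 : γ = 0
  · exact ⟨0, 0, by simp [hγ0]⟩
  obtain ⟨a, ha⟩ := hr
  obtain ⟨b, hb⟩ := hγq
  have hζΩ : IsPrimitiveRoot (algebraMap F Ω ζ) q := hζ.map_of_injective (algebraMap F Ω).injective
  by_cases hfix : ∀ σ : Ω ≃ₐ[F] Ω, σ r = r
  · have h1 : r ∈ (⊥ : IntermediateField F Ω) := (InfiniteGalois.mem_bot_iff_fixed r).2 hfix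
    have h2 : F⟮r⟯ = ⊥ := by rw [adjoin_simple_eq_bot_iff]; exact h1
    rw [h2] at hγ
    obtain ⟨c, hc⟩ := mem_bot.1 hγ
    exact ⟨0, c, by simp [hc]⟩
  push Not at hfix
  obtain ⟨σ, hσ⟩ := hfix
  have key : ∀ (τ : Ω ≃ₐ[F] Ω) (x : Ω) (y : F), x ≠ 0 → algebraMap F Ω y = x ^ q →
      (τ x / x) ^ q = 1 := by
    intro τ x y hx hy
    have : τ x ^ q = x ^ q := by rw [← map_pow, ← hy, AlgEquiv.commutes]
    rw [div_pow, this, div_self (pow_ne_zero _ hx)]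
  set ξ := σ r / r with hξ
  have hξq : ξ ^ q = 1 := key σ r a hr0 ha
  have hξ1 : ξ ≠ 1 := fun h => hσ (by rwa [hξ, div_eq_one_iff_eq hr0] at h)
  have hξp : IsPrimitiveRoot ξ q := by
    have := Fact.mk hq
    rw [← orderOf_eq_prime_iff.2 ⟨hξq, hξ1⟩] 
    exact IsPrimitiveRoot.orderOf ξ
  obtain ⟨i, -, hi⟩ := hζΩ.eq_pow_of_pow_eq_one hξq
  have hξfix : ∀ τ : Ω ≃ₐ[F] Ω, τ ξ = ξ := by
    intro τ; rw [← hi, map_pow, AlgEquiv.commutes]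
  have hσr : σ r = ξ * r := by rw [hξ]; field_simp
  obtain ⟨j, -, hj⟩ := hξp.eq_pow_of_pow_eq_one (key σ γ b hγ0 hb)
  have hσγ : σ γ = ξ ^ j * γ := by rw [hj]; field_simp
  have hξ0 : ξ ≠ 0 := by intro h; rw [h, zero_pow hq.ne_zero] at hξq; exact zero_ne_one hξq
  have hc : σ (γ / r ^ j) = γ / r ^ j := by
    rw [map_div₀, map_pow, hσγ, hσr, mul_pow]
    field_simp
  have hpow : ∀ m : ℕ, (σ ^ m) r = ξ ^ m * r := by
    intro m
    induction m with
    | zero => simp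
    | succ m ih =>
      rw [pow_succ, AlgEquiv.mul_apply, hσr, map_mul, hξfix, ih]; ring
  have hpow' : ∀ m : ℕ, (σ ^ m) (γ / r ^ j) = γ / r ^ j := by
    intro m
    induction m with
    | zero => simp
    | succ m ih => rw [pow_succ, AlgEquiv.mul_apply, hc, ih]
  have hbot : γ / r ^ j ∈ (⊥ : IntermediateField F Ω) := by
    rw [InfiniteGalois.mem_bot_iff_fixed]
    intro τ
    obtain ⟨m, -, hm⟩ := hξp.eq_pow_of_pow_eq_one (key τ r a hr0 ha)
    have hτr : τ r = (σ ^ m) r := by rw [hpow, hm]; field_simp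
    have hmem : γ / r ^ j ∈ F⟮r⟯ := div_mem hγ (pow_mem (mem_adjoin_simple_self F r) _)
    have hall : ∀ x ∈ F⟮r⟯, τ x = (σ ^ m) x := by
      intro x hx
      induction hx using adjoin_induction with
      | mem x hx => rw [Set.mem_singleton_iff.1 hx, hτr]
      | algebraMap x => simp
      | add x y _ _ hx hy => rw [map_add, map_add, hx, hy]
      | inv x _ hx => rw [map_inv₀, map_inv₀, hx]
      | mul x y _ _ hx hy => rw [map_mul, map_mul, hx, hy]
    rw [hall _ hmem, hpow']
  obtain ⟨c, hc⟩ := mem_bot.1 hbot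
  refine ⟨j, c, ?_⟩
  rw [hc]; field_simp

theorem sw_induct {Ω : Type*} [Field Ω] [CharZero Ω] [IsGalois ℚ Ω] (q : ℕ)
    (hq : q.Prime) (ζ : Ω) (hζ : IsPrimitiveRoot ζ q) {ι : Type*} [DecidableEq ι] (β : ι → Ω)
    (hβ0 : ∀ i, β i ≠ 0) (hβ : ∀ i, β i ^ q ∈ ℚ⟮ζ⟯) (s : Finset ι) :
    ∀ γ ∈ adjoin ℚ ({ζ} ∪ β '' (s : Set ι)), γ ^ q ∈ ℚ⟮ζ⟯ →
      ∃ (e : ι → ℕ) (c : Ω), c ∈ ℚ⟮ζ⟯ ∧ γ = c * ∏ i ∈ s, β i ^ e i := by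
  induction s using Finset.induction_on with
  | empty =>
    intro γ hγ _
    exact ⟨0, γ, by simpa using hγ, by simp⟩
  | insert i s hi ih =>
    intro γ hγ hγq
    set F := adjoin ℚ ({ζ} ∪ β '' (s : Set ι)) with hF
    have hle : ℚ⟮ζ⟯ ≤ F := adjoin.mono _ _ _ Set.subset_union_left
    have hζF : ζ ∈ F := hle (mem_adjoin_simple_self ℚ ζ)
    have h1 : γ ∈ adjoin F {β i} := by
      have h2 := adjoin_adjoin_left ℚ ({ζ} ∪ β '' (s : Set ι)) {β i}
      rw [← hF] at h2
      refine (SetLike.ext_iff.1 h2 γ).2 ?_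
      convert hγ using 2
      rw [Finset.coe_insert, Set.image_insert_eq]
      ext x; simp
    obtain ⟨j, c, hc⟩ := sw_step (F := F) (Ω := Ω) q hq ⟨ζ, hζF⟩
      (IsPrimitiveRoot.of_map_of_injective (f := algebraMap F Ω) hζ (algebraMap F Ω).injective)
      (β i) γ (hβ0 i) ⟨⟨_, hle (hβ i)⟩, rfl⟩ h1 ⟨⟨_, hle hγq⟩, rfl⟩
    have hcq : (c : Ω) ^ q ∈ ℚ⟮ζ⟯ := by
      have : (c : Ω) ^ q = γ ^ q / (β i ^ q) ^ j := by
        rw [hc, mul_pow, ← pow_mul, ← pow_mul, mul_comm q j]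
        have := hβ0 i
        change _ = (c : Ω) ^ q * _ / _
        field_simp
      rw [this]
      exact div_mem hγq (pow_mem (hβ i) _)
    obtain ⟨e, c', hc', he⟩ := ih c c.2 hcq
    refine ⟨Function.update e i j, c', hc', ?_⟩
    rw [hc, Finset.prod_insert hi, Function.update_self]
    change (c : Ω) * _ = _
    rw [he]
    have : ∏ k ∈ s, β k ^ Function.update e i j k = ∏ k ∈ s, β k ^ e k :=
      Finset.prod_congr rfl fun k hk => by
        rw [Function.update_of_ne]; rintro rfl; exact hi hk
    rw [this]; ring

theorem sw_rat_pow {Ω : Type*} [Field Ω] [CharZero Ω] (q : ℕ)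
    (hq : q.Prime) (ζ : Ω) (hζ : IsPrimitiveRoot ζ q) (c : Ω) (hc : c ∈ ℚ⟮ζ⟯) (d : ℚ)
    (hd : c ^ q = algebraMap ℚ Ω d) (hd0 : d ≠ 0) : ∃ z : ℚ, d = z ^ q := by
  have hintg : IsIntegral ℚ ζ := (hζ.isIntegral hq.pos).tower_top
  have hfin : FiniteDimensional ℚ ℚ⟮ζ⟯ := adjoin.finiteDimensional hintg
  have hrank : Module.finrank ℚ ℚ⟮ζ⟯ = q - 1 := by
    rw [adjoin.finrank hintg, ← Polynomial.cyclotomic_eq_minpoly_rat hζ hq.pos,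
      Polynomial.natDegree_cyclotomic, Nat.totient_prime hq]
  have h1 : (⟨c, hc⟩ : ℚ⟮ζ⟯) ^ q = algebraMap ℚ ℚ⟮ζ⟯ d := by
    apply Subtype.ext; simpa using hd
  have h2 := congrArg (Algebra.norm ℚ) h1
  rw [map_pow, Algebra.norm_algebraMap, hrank] at h2
  set y := Algebra.norm ℚ (⟨c, hc⟩ : ℚ⟮ζ⟯)
  have hy : y ≠ 0 := by
    intro h; rw [h, zero_pow hq.ne_zero] at h2; exact pow_ne_zero _ hd0 h2.symm
  refine ⟨d / y, ?_⟩
  rw [div_pow, h2, eq_div_iff (pow_ne_zero _ hd0), ← pow_succ']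
  congr 1
  have := hq.pos
  omega

theorem sw_valuation (q : ℕ) (hq : q.Prime) {n : ℕ} (p : Fin n → ℕ) (hp : ∀ i, (p i).Prime)
    (hinj : Function.Injective p) (i0 : Fin n) (m e : Fin n → ℕ) (z : ℚ)
    (h : (p i0 : ℚ) = z ^ q * ∏ i ∈ Finset.univ.erase i0, ((p i : ℚ) * (p i0 : ℚ) ^ m i) ^ e i) :
    False := by
  have hp0 : ∀ i, (p i : ℚ) ≠ 0 := fun i => by exact_mod_cast (hp i).ne_zero
  have hz : z ≠ 0 := by
    rintro rfl
    rw [zero_pow hq.ne_zero, zero_mul] at h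
    exact hp0 _ h
  have hself : ∀ i, haveI := Fact.mk (hp i); padicValRat (p i) (p i : ℚ) = 1 := by
    intro i
    have := Fact.mk (hp i)
    exact padicValRat.self (hp i).one_lt
  have hother : ∀ i j, i ≠ j → padicValRat (p i) (p j : ℚ) = 0 := by
    intro i j hij
    have := Fact.mk (hp i)
    rw [padicValRat.of_nat]
    have : ¬ p i ∣ p j := fun hd => hij (hinj ((Nat.prime_dvd_prime_iff_eq (hp i) (hp j)).1 hd))
    rw [padicValNat.eq_zero_of_not_dvd this]; rfl
  have hval : ∀ k, padicValRat (p k) (p i0 : ℚ) = q * padicValRat (p k) z +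
      ∑ i ∈ Finset.univ.erase i0, (e i : ℤ) * (padicValRat (p k) (p i : ℚ) +
        m i * padicValRat (p k) (p i0 : ℚ)) := by
    intro k
    have := Fact.mk (hp k)
    have hfac : ∀ i, ((p i : ℚ) * (p i0 : ℚ) ^ m i) ^ e i ≠ 0 := fun i =>
      pow_ne_zero _ (mul_ne_zero (hp0 _) (pow_ne_zero _ (hp0 _)))
    have hprod : ∀ s : Finset (Fin n), padicValRat (p k)
        (∏ i ∈ s, ((p i : ℚ) * (p i0 : ℚ) ^ m i) ^ e i) =
        ∑ i ∈ s, (e i : ℤ) * (padicValRat (p k) (p i : ℚ) +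
        m i * padicValRat (p k) (p i0 : ℚ)) := by
      intro s
      induction s using Finset.induction_on with
      | empty => simp
      | insert i s hi ih =>
        rw [Finset.prod_insert hi, Finset.sum_insert hi, padicValRat.mul (hfac i)
          (Finset.prod_ne_zero_iff.2 fun i _ => hfac i), ih, padicValRat.pow,
          padicValRat.mul (hp0 _) (pow_ne_zero _ (hp0 _)), padicValRat.pow]
    conv_lhs => rw [h]
    rw [padicValRat.mul (pow_ne_zero _ hz) (Finset.prod_ne_zero_iff.2 fun i _ => hfac i),
      hprod, padicValRat.pow]
  have hdvd : ∀ k, k ≠ i0 → (q : ℤ) ∣ e k := by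
    intro k hk
    have h1 := hval k
    rw [hother k i0 hk, Finset.sum_eq_single k] at h1
    · rw [hself k] at h1
      exact ⟨-padicValRat (p k) z, by linarith⟩
    · intro i _ hik
      rw [hother k i hik.symm]; simp
    · intro hk'; exact absurd (Finset.mem_erase.2 ⟨hk, Finset.mem_univ _⟩) hk'
  have h1 := hval i0
  rw [hself i0] at h1
  have h2 : (q : ℤ) ∣ 1 := by
    rw [h1]
    refine dvd_add (dvd_mul_right _ _) (Finset.dvd_sum fun i hi => ?_)
    exact Dvd.dvd.mul_right (hdvd i (Finset.ne_of_mem_erase hi)) _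
  have := hq.one_lt
  have := Int.le_of_dvd one_pos h2
  omega

theorem sw_field_aux (Ω : Type) [Field Ω] [CharZero Ω] [IsAlgClosed Ω] [IsGalois ℚ Ω] (q : ℕ) (hq : q.Prime) {n : ℕ} (p : Fin n → ℕ) (hp : ∀ i, (p i).Prime)
    (hinj : Function.Injective p) (i0 : Fin n) (m : Fin n → ℕ) :
    ∃ (E : Type) (_ : Field E) (_ : NumberField E) (ζ : E) (β : Fin n → E),
      IsPrimitiveRoot ζ q ∧ (∀ i, i ≠ i0 → β i ^ q = (p i : E) * (p i0 : E) ^ m i) ∧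
      ∀ c : E, c ^ q ≠ p i0 := by
  have : NeZero (q : Ω) := ⟨by exact_mod_cast hq.ne_zero⟩
  obtain ⟨ζ, hζ⟩ := HasEnoughRootsOfUnity.exists_primitiveRoot Ω q
  have hex : ∀ i, ∃ b : Ω, b ^ q = (p i : Ω) * (p i0 : Ω) ^ m i := fun i =>
    IsAlgClosed.exists_pow_nat_eq _ hq.pos
  choose β hβ using hex
  have hp0 : ∀ i, (p i : Ω) ≠ 0 := fun i => by exact_mod_cast (hp i).ne_zero
  have hβ0 : ∀ i, β i ≠ 0 := by
    intro i h
    have := hβ i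
    rw [h, zero_pow hq.ne_zero] at this
    exact mul_ne_zero (hp0 _) (pow_ne_zero _ (hp0 _)) this.symm
  have hβq : ∀ i, β i ^ q ∈ ℚ⟮ζ⟯ := by
    intro i; rw [hβ]
    exact mul_mem (IntermediateField.natCast_mem _ _) (pow_mem (IntermediateField.natCast_mem _ _) _)
  let s : Finset (Fin n) := Finset.univ.erase i0
  let E := adjoin ℚ ({ζ} ∪ β '' (s : Set (Fin n)))
  have hζE : ζ ∈ E := subset_adjoin _ _ (Or.inl rfl)
  have hβE : ∀ i, i ≠ i0 → β i ∈ E := fun i hi =>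
    subset_adjoin _ _ (Or.inr ⟨i, by simp [s, hi], rfl⟩)
  have hfd : FiniteDimensional ℚ E := by
    apply finiteDimensional_adjoin
    intro x _
    exact Algebra.IsIntegral.isIntegral x
  have hnf : NumberField E := {}
  refine ⟨E, inferInstance, hnf, ⟨ζ, hζE⟩, fun i => if h : i ≠ i0 then ⟨β i, hβE i h⟩ else 0,
    ?_, ?_, ?_⟩
  · exact IsPrimitiveRoot.of_map_of_injective (f := algebraMap E Ω) hζ (algebraMap E Ω).injective
  · intro i hi
    simp only [dif_pos hi]
    apply Subtype.ext
    simpa using hβ i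
  · intro c hc
    have hc' : (c : Ω) ^ q = (p i0 : Ω) := by
      have := congrArg (algebraMap E Ω) hc
      simpa using this
    obtain ⟨e, c₀, hc₀, he⟩ := sw_induct q hq ζ hζ β hβ0 hβq s c c.2 (by
      rw [hc']; exact IntermediateField.natCast_mem _ _)
    have h1 : (p i0 : Ω) = c₀ ^ q * ∏ i ∈ s, ((p i : Ω) * (p i0 : Ω) ^ m i) ^ e i := by
      conv_lhs => rw [← hc', he, mul_pow, ← Finset.prod_pow]
      congr 1
      refine Finset.prod_congr rfl fun i _ => ?_
      rw [← hβ, ← pow_mul, ← pow_mul, mul_comm]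
    have hpQ : ∀ i, (p i : ℚ) ≠ 0 := fun i => by exact_mod_cast (hp i).ne_zero
    set R : ℚ := ∏ i ∈ s, ((p i : ℚ) * (p i0 : ℚ) ^ m i) ^ e i with hR
    have hR0 : R ≠ 0 := Finset.prod_ne_zero_iff.2 fun i _ =>
      pow_ne_zero _ (mul_ne_zero (hpQ _) (pow_ne_zero _ (hpQ _)))
    have hRΩ : algebraMap ℚ Ω R = ∏ i ∈ s, ((p i : Ω) * (p i0 : Ω) ^ m i) ^ e i := by
      rw [hR, map_prod]; simp
    have h2 : c₀ ^ q = algebraMap ℚ Ω (p i0 / R) := by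
      rw [map_div₀, hRΩ, eq_div_iff, ← h1, map_natCast]
      rw [← hRΩ]
      simpa using hR0
    obtain ⟨z, hz⟩ := sw_rat_pow q hq ζ hζ c₀ hc₀ _ h2 (div_ne_zero (hpQ _) hR0)
    refine sw_valuation q hq p hp hinj i0 m e z ?_
    rw [← hz, ← hR]
    field_simp

theorem sw_algcl (k : Type) [Field k] : IsAlgClosure k (AlgebraicClosure k) := inferInstance

theorem sw_field (q : ℕ) (hq : q.Prime) {n : ℕ} (p : Fin n → ℕ) (hp : ∀ i, (p i).Prime)
    (hinj : Function.Injective p) (i0 : Fin n) (m : Fin n → ℕ) :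
    ∃ (E : Type) (_ : Field E) (_ : NumberField E) (ζ : E) (β : Fin n → E),
      IsPrimitiveRoot ζ q ∧ (∀ i, i ≠ i0 → β i ^ q = (p i : E) * (p i0 : E) ^ m i) ∧
      ∀ c : E, c ^ q ≠ p i0 := by
  have h : IsGalois ℚ (AlgebraicClosure ℚ) := by
    have : IsAlgClosure ℚ (AlgebraicClosure ℚ) := by
      have key : (DivisionRing.toRatAlgebra : Algebra ℚ (AlgebraicClosure ℚ)) =
          AlgebraicClosure.instAlgebra ℚ := Subsingleton.elim _ _
      rw [key]
      exact sw_algcl ℚ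
    exact IsAlgClosure.isGalois ℚ (AlgebraicClosure ℚ)
  exact sw_field_aux (AlgebraicClosure ℚ) q hq p hp hinj i0 m
end

section
open NumberField

theorem sw_pow_mul_dvd {k : Type*} [Field k] (q : ℕ) (hq : q.Prime) (g : k) (hg : g ≠ 0)
    (hng : ¬ ∃ y : k, y ^ q = g) (T : ℤ) (hT : ∃ y : k, y ^ q = g ^ T) : (q : ℤ) ∣ T := by
  by_contra hd
  obtain ⟨y, hy⟩ := hT
  have hco : IsCoprime (q : ℤ) T := (Nat.prime_iff_prime_int.1 hq).coprime_iff_not_dvd.2 hd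
  obtain ⟨u, w, huw⟩ := hco
  apply hng
  refine ⟨g ^ u * y ^ w, ?_⟩
  rw [mul_pow, ← zpow_natCast (y ^ w), zpow_comm, zpow_natCast, hy, ← zpow_natCast (g ^ u),
    ← zpow_mul, ← zpow_mul, ← zpow_add₀ hg, mul_comm T w, huw, zpow_one]

theorem sw_prime_exists (q : ℕ) (hq : q.Prime) {n : ℕ} (p : Fin n → ℕ) (hp : ∀ i, (p i).Prime)
    (hinj : Function.Injective p) (v : Fin n → ZMod q) (hv : v ≠ 0) (Δ : ℕ) (hΔ : Δ ≠ 0) :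
    ∃ l : ℕ, l.Prime ∧ ¬ l ∣ Δ ∧ ∀ a : Fin n → ℕ,
      (∃ x : ℤ, (l : ℤ) ∣ x ^ q - ∏ i, (p i : ℤ) ^ a i) → ∑ i, (a i : ZMod q) * v i = 0 := by
  have := Fact.mk hq
  obtain ⟨i0, hi0⟩ := Function.ne_iff.1 hv
  rw [Pi.zero_apply] at hi0
  let m : Fin n → ℕ := fun i => (-(v i) / v i0).val
  have hm : ∀ i, (m i : ZMod q) = -(v i) / v i0 := fun i => ZMod.natCast_zmod_val _
  obtain ⟨E, _, _, ζ, β, hζ, hβ, hE⟩ := sw_field q hq p hp hinj i0 m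
  obtain ⟨P, hP, hPn, hMP, hPx⟩ := sw_kummer E q hq (p i0) (hp i0).ne_zero ζ hζ hE
    (Δ * ∏ i, p i) (mul_ne_zero hΔ (Finset.prod_ne_zero_iff.2 fun i _ => (hp i).ne_zero))
  have hPp : P.IsPrime := Ideal.isPrime_of_prime hP
  have hPm : P.IsMaximal := hPp.isMaximal hP.ne_zero
  let _ : Field (𝓞 E ⧸ P) := Ideal.Quotient.field P
  let π := Ideal.Quotient.mk P
  have hmem : ((Ideal.absNorm P : ℕ) : 𝓞 E) ∈ P := Ideal.absNorm_mem P
  have hπ0 : ∀ i, (p i : 𝓞 E ⧸ P) ≠ 0 := by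
    intro i h
    apply hMP
    have : (p i : 𝓞 E) ∈ P := by
      rw [← Ideal.Quotient.eq_zero_iff_mem, map_natCast]; exact h
    obtain ⟨c, hc⟩ : p i ∣ Δ * ∏ i, p i :=
      Dvd.dvd.mul_left (Finset.dvd_prod_of_mem _ (Finset.mem_univ i)) _
    rw [hc, Nat.cast_mul]
    exact P.mul_mem_right _ this
  refine ⟨Ideal.absNorm P, hPn, ?_, ?_⟩
  · rintro ⟨c, hc⟩
    apply hMP
    rw [hc, mul_assoc, Nat.cast_mul]
    exact P.mul_mem_right _ hmem
  rintro a ⟨x, hx⟩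
  have hx' : (x : 𝓞 E ⧸ P) ^ q = ∏ i, (p i : 𝓞 E ⧸ P) ^ a i := by
    obtain ⟨c, hc⟩ := hx
    have h1 := congrArg (fun z : ℤ => (z : 𝓞 E ⧸ P)) hc
    have h2 : ((Ideal.absNorm P : ℕ) : 𝓞 E ⧸ P) = 0 := by
      rw [← map_natCast π]; exact Ideal.Quotient.eq_zero_iff_mem.2 hmem
    push_cast at h1
    rw [h2, zero_mul, sub_eq_zero] at h1
    exact h1
  have hβ' : ∀ i, ∃ y : 𝓞 E ⧸ P, i ≠ i0 →
      y ^ q = (p i : 𝓞 E ⧸ P) * (p i0 : 𝓞 E ⧸ P) ^ m i := by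
    intro i
    by_cases hi : i = i0
    · exact ⟨0, fun h => absurd hi h⟩
    have hintg : IsIntegral ℤ (β i) := by
      refine IsIntegral.of_pow hq.pos ?_
      rw [hβ i hi]
      have h := isIntegral_algebraMap (R := ℤ) (A := E) (x := (p i * p i0 ^ m i : ℤ))
      simpa using h
    obtain ⟨b, hb⟩ : ∃ b : 𝓞 E, algebraMap (𝓞 E) E b = β i := ⟨⟨β i, hintg⟩, rfl⟩
    have h1 : b ^ q = (p i : 𝓞 E) * (p i0 : 𝓞 E) ^ m i := by
      apply RingOfIntegers.coe_injective
      rw [map_pow, hb, hβ i hi]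
      simp
    refine ⟨π b, fun _ => ?_⟩
    rw [← map_pow, h1]; simp
  choose y hy using hβ'
  have hng : ¬ ∃ z : 𝓞 E ⧸ P, z ^ q = (p i0 : 𝓞 E ⧸ P) := by
    rintro ⟨z, hz⟩
    obtain ⟨z, rfl⟩ := Ideal.Quotient.mk_surjective z
    apply hPx
    refine ⟨z, ?_⟩
    rw [← Ideal.Quotient.eq, map_pow, hz, map_natCast]
  set s : Finset (Fin n) := Finset.univ.erase i0 with hs
  let T : ℤ := a i0 - ∑ i ∈ s, (m i * a i : ℤ)
  have hT : (q : ℤ) ∣ T := by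
    refine sw_pow_mul_dvd q hq (p i0 : 𝓞 E ⧸ P) (hπ0 i0) hng T ⟨x / ∏ i ∈ s, y i ^ a i, ?_⟩
    have h1 : (∏ i ∈ s, y i ^ a i) ^ q = (∏ i ∈ s, (p i : 𝓞 E ⧸ P) ^ a i) *
        (p i0 : 𝓞 E ⧸ P) ^ (∑ i ∈ s, m i * a i) := by
      rw [← Finset.prod_pow, ← Finset.prod_pow_eq_pow_sum, ← Finset.prod_mul_distrib]
      refine Finset.prod_congr rfl fun i hi => ?_
      rw [← pow_mul, mul_comm (a i) q, pow_mul, hy i (Finset.ne_of_mem_erase hi), mul_pow,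
        ← pow_mul]
    have h2 : (x : 𝓞 E ⧸ P) ^ q = (p i0 : 𝓞 E ⧸ P) ^ a i0 *
        ∏ i ∈ s, (p i : 𝓞 E ⧸ P) ^ a i := by
      rw [hx']
      exact (Finset.mul_prod_erase Finset.univ (fun i => (p i : 𝓞 E ⧸ P) ^ a i)
        (Finset.mem_univ i0)).symm
    have h3 : (∏ i ∈ s, (p i : 𝓞 E ⧸ P) ^ a i) ≠ 0 :=
      Finset.prod_ne_zero_iff.2 fun i _ => pow_ne_zero _ (hπ0 i)
    have h4 : (p i0 : 𝓞 E ⧸ P) ^ T = (p i0 : 𝓞 E ⧸ P) ^ a i0 /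
        (p i0 : 𝓞 E ⧸ P) ^ (∑ i ∈ s, m i * a i) := by
      rw [← zpow_natCast, ← zpow_natCast, ← zpow_sub₀ (hπ0 i0)]
      congr 1
      simp [T]
    have h5 := pow_ne_zero (∑ i ∈ s, m i * a i) (hπ0 i0)
    rw [div_pow, h1, h2, h4]
    field_simp
  have hTz : (T : ZMod q) = 0 := (ZMod.intCast_zmod_eq_zero_iff_dvd _ _).2 hT
  have hfin : ∑ i, (a i : ZMod q) * v i = v i0 * (T : ZMod q) := by
    rw [← Finset.add_sum_erase _ _ (Finset.mem_univ i0)]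
    simp only [T]
    push_cast
    rw [mul_sub, mul_comm, sub_eq_add_neg]
    congr 1
    rw [Finset.mul_sum, ← Finset.sum_neg_distrib]
    refine Finset.sum_congr rfl fun i _ => ?_
    rw [hm]
    field_simp
  rw [hfin, hTz, mul_zero]

theorem sw_local (q : ℕ) {n : ℕ} (p : Fin n → ℕ) (l : ℕ) (hl : l.Prime)
    (hp : ∀ i, ¬ l ∣ p i) : ∃ w : Fin n → ZMod q, ∀ a : Fin n → ℕ,
      ∑ i, (a i : ZMod q) * w i = 0 → ∃ x : ℤ, (l : ℤ) ∣ x ^ q - ∏ i, (p i : ℤ) ^ a i := by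
  have := Fact.mk hl
  obtain ⟨g, hg⟩ := IsCyclic.exists_monoid_generator (α := (ZMod l)ˣ)
  have h1 : ∀ i, ∃ t : ℕ, ((g ^ t : (ZMod l)ˣ) : ZMod l) = p i := by
    intro i
    have h0 : (p i : ZMod l) ≠ 0 := by rw [Ne, ZMod.natCast_eq_zero_iff]; exact hp i
    obtain ⟨t, ht⟩ := Submonoid.mem_powers_iff _ _ |>.1 (hg (Units.mk0 _ h0))
    exact ⟨t, by rw [ht]; rfl⟩
  choose t ht using h1
  refine ⟨fun i => t i, fun a ha => ?_⟩
  have h2 : q ∣ ∑ i, a i * t i := by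
    rw [← ZMod.natCast_eq_zero_iff]; push_cast; exact ha
  obtain ⟨m, hm⟩ := h2
  obtain ⟨x, hx⟩ := ZMod.intCast_surjective ((g ^ m : (ZMod l)ˣ) : ZMod l)
  refine ⟨x, ?_⟩
  rw [← ZMod.intCast_zmod_eq_zero_iff_dvd]
  push_cast
  rw [hx, sub_eq_zero]
  simp only [← ht]
  push_cast
  simp only [← pow_mul]
  rw [Finset.prod_pow_eq_pow_sum, mul_comm m q, ← hm]
  congr 1
  exact Finset.sum_congr rfl fun i _ => mul_comm _ _

theorem sw_lift (q : ℕ) (s : ℤ) (N : ℕ) : 0 < N → N.Coprime q →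
    (∀ l : ℕ, l.Prime → l ∣ N → ¬ (l : ℤ) ∣ s ∧ ∃ x : ℤ, (l : ℤ) ∣ x ^ q - s) →
    ∃ x : ℤ, (N : ℤ) ∣ x ^ q - s := by
  induction N using induction_on_primes with
  | zero => intro h; omega
  | one => intros; exact ⟨0, by simp⟩
  | prime_mul l a hl ih =>
    intro hpos hco h
    have ha : 0 < a := Nat.pos_of_mul_pos_left hpos
    obtain ⟨x, c, hx⟩ := ih ha (Nat.Coprime.coprime_mul_left hco)
      (fun r hr hra => h r hr (hra.mul_left _))
    obtain ⟨hls, y, hy⟩ := h l hl (dvd_mul_right _ _)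
    have hlp : Prime (l : ℤ) := Nat.prime_iff_prime_int.1 hl
    by_cases hla : l ∣ a
    · have hlq : ¬ (l : ℤ) ∣ q := by
        intro hd
        have h1 : l ∣ q := by exact_mod_cast hd
        have h2 := Nat.dvd_gcd (dvd_mul_right l a) h1
        rw [hco] at h2
        exact hl.one_lt.ne' (Nat.dvd_one.1 h2)
      have hla' : (l : ℤ) ∣ a := by exact_mod_cast hla
      have hq0 : q ≠ 0 := by rintro rfl; exact hlq (by simp)
      have hlx : ¬ (l : ℤ) ∣ x := by
        intro hd
        apply hls
        have h1 : (l : ℤ) ∣ x ^ q := dvd_pow hd hq0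
        have h2 : (l : ℤ) ∣ x ^ q - s := by rw [hx]; exact hla'.mul_right _
        simpa using dvd_sub h1 h2
      have hunit : IsCoprime (l : ℤ) (q * x ^ (q - 1)) := by
        rw [hlp.coprime_iff_not_dvd]
        intro hd
        rcases hlp.dvd_or_dvd hd with hd | hd
        · exact hlq hd
        · exact hlx (hlp.dvd_of_dvd_pow hd)
      obtain ⟨u, w, huw⟩ := hunit
      obtain ⟨K, hK⟩ := Polynomial.powAddExpansion x (-(w * c) * a) q
      obtain ⟨a', ha'⟩ := hla'
      refine ⟨x + -(w * c) * a, c * u + K * (w * c) ^ 2 * a', ?_⟩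
      rw [hK]
      push_cast
      have : (a : ℤ) ^ 2 = l * a * a' := by
        rw [sq]; nth_rewrite 2 [ha']; ring
      linear_combination hx + (-(a : ℤ) * c) * huw + K * (w * c) ^ 2 * this
    · have hcop : IsCoprime (l : ℤ) (a : ℤ) :=
        Nat.isCoprime_iff_coprime.2 ((Nat.Prime.coprime_iff_not_dvd hl).2 hla)
      obtain ⟨u, w, huw⟩ := hcop
      refine ⟨x * (u * l) + y * (w * a), ?_⟩
      push_cast
      refine IsCoprime.mul_dvd ⟨u, w, huw⟩ ?_ ?_
      · have h1 : (l : ℤ) ∣ (x * (u * l) + y * (w * a)) - y :=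
          ⟨u * (x - y), by linear_combination y * huw⟩
        have h2 := h1.trans (sub_dvd_pow_sub_pow _ y q)
        have h3 := dvd_add h2 hy
        simpa using h3
      · have h1 : (a : ℤ) ∣ (x * (u * l) + y * (w * a)) - x :=
          ⟨w * (y - x), by linear_combination x * huw⟩
        have h2 := h1.trans (sub_dvd_pow_sub_pow _ x q)
        have h3 := dvd_add h2 ⟨c, hx⟩
        simpa using h3

theorem sw_main (q k : ℕ) (hq : q.Prime) {n r : ℕ} (hn : 1 ≤ n) (p : Fin n → ℕ)
    (hp : ∀ i, (p i).Prime) (hinj : Function.Injective p) (ν : Fin r → Fin n → ℕ) :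
    (∃ Δ : ℕ, 0 < Δ ∧ ∀ N : ℕ, 0 < N → N.primeFactorsList.length ≤ k → Nat.Coprime N Δ →
      ∃ j, ∃ x : ℤ, (N : ℤ) ∣ x ^ q - ∏ i, (p i : ℤ) ^ ν j i) ↔
    ∀ v : Fin k → Fin n → ZMod q, ∃ j, ∀ t, ∑ i, (ν j i : ZMod q) * v t i = 0 := by
  have := Fact.mk hq
  constructor
  · rintro ⟨Δ, hΔ, h⟩ v
    have hex : ∀ t, ∃ l : ℕ, l.Prime ∧ ¬ l ∣ Δ ∧ ∀ a : Fin n → ℕ,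
      (∃ x : ℤ, (l : ℤ) ∣ x ^ q - ∏ i, (p i : ℤ) ^ a i) → ∑ i, (a i : ZMod q) * v t i = 0 := by
      intro t
      by_cases hv : v t = 0
      · obtain ⟨l, h1, h2, -⟩ := sw_prime_exists q hq p hp hinj (fun _ => 1)
          (fun h0 => one_ne_zero (congrFun h0 ⟨0, hn⟩)) Δ hΔ.ne'
        exact ⟨l, h1, h2, fun a _ => by simp [hv]⟩
      · exact sw_prime_exists q hq p hp hinj (v t) hv Δ hΔ.ne'
    choose l hl hlΔ hlv using hex
    have hperm := Nat.primeFactorsList_unique (n := ∏ t, l t) (l := List.ofFn l)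
      (List.prod_ofFn) (by
        intro z hz
        obtain ⟨t, rfl⟩ := (List.mem_ofFn' _ _).1 hz
        exact hl t)
    obtain ⟨j, x, hx⟩ := h (∏ t, l t) (Finset.prod_pos fun t _ => (hl t).pos)
      (by rw [← hperm.length_eq]; simp)
      (Nat.Coprime.prod_left fun t _ => (Nat.Prime.coprime_iff_not_dvd (hl t)).2 (hlΔ t))
    refine ⟨j, fun t => hlv t (ν j) ⟨x, ?_⟩⟩
    refine dvd_trans ?_ hx
    exact_mod_cast Finset.dvd_prod_of_mem l (Finset.mem_univ t)
  · intro h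
    refine ⟨q * ∏ i, p i, Nat.mul_pos hq.pos (Finset.prod_pos fun i _ => (hp i).pos), ?_⟩
    intro N hN hk hco
    have hcoq : N.Coprime q := Nat.Coprime.coprime_mul_right_right hco
    have hcop : ∀ i, N.Coprime (p i) := fun i =>
      Nat.Coprime.coprime_dvd_right (Finset.dvd_prod_of_mem p (Finset.mem_univ i))
        (Nat.Coprime.coprime_mul_left_right hco)
    have hnd : ∀ l : ℕ, l.Prime → l ∣ N → ∀ i, ¬ l ∣ p i := by
      intro l hl hlN i hd
      have := Nat.dvd_gcd hlN hd
      rw [hcop i] at this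
      exact hl.one_lt.ne' (Nat.dvd_one.1 this)
    have hex : ∀ l : ℕ, ∃ w : Fin n → ZMod q, l.Prime → l ∣ N → ∀ a : Fin n → ℕ,
      ∑ i, (a i : ZMod q) * w i = 0 → ∃ x : ℤ, (l : ℤ) ∣ x ^ q - ∏ i, (p i : ℤ) ^ a i := by
      intro l
      by_cases hl : l.Prime ∧ l ∣ N
      · obtain ⟨w, hw⟩ := sw_local q p l hl.1 (hnd l hl.1 hl.2)
        exact ⟨w, fun _ _ => hw⟩
      · exact ⟨0, fun h1 h2 => absurd ⟨h1, h2⟩ hl⟩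
    choose w hw using hex
    obtain ⟨j, hj⟩ := h fun t => w (N.primeFactorsList.getD t 0)
    refine ⟨j, sw_lift q _ N hN hcoq ?_⟩
    intro l hl hlN
    refine ⟨?_, ?_⟩
    · intro hd
      obtain ⟨i, -, hi⟩ := (Prime.dvd_finsetProd_iff (Nat.prime_iff_prime_int.1 hl) _).1 hd
      have := (Nat.prime_iff_prime_int.1 hl).dvd_of_dvd_pow hi
      exact hnd l hl hlN i (by exact_mod_cast this)
    · apply hw l hl hlN
      obtain ⟨t, ht, rfl⟩ := List.mem_iff_getElem.1 ((Nat.mem_primeFactorsList hN.ne').2 ⟨hl, hlN⟩)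
      have := hj ⟨t, ht.trans_le hk⟩
      simp only [List.getD_eq_getElem _ _ ht] at this
      exact this
end

/-- **Corollary (switching of primes).** Membership in `𝒯_{k,q}` only depends on the
factorization shape: replacing the distinct primes `p_i` by distinct primes `p̄_i`
preserves membership in `𝒯_{k,q}`. -/
theorem stmt4 (q k n ℓ : ℕ) (hq : q.Prime) (hodd : Odd q) (hk : 1 ≤ k)
    (hn : 1 ≤ n) (hℓ : 1 ≤ ℓ)
    (p pbar : Fin n → ℕ) (hp : ∀ i, (p i).Prime) (hpinj : Function.Injective p)
    (hpbar : ∀ i, (pbar i).Prime) (hpbarinj : Function.Injective pbar)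
    (ν : Fin ℓ → Fin n → ℕ)
    (hpow : ∀ j : Fin ℓ, ¬ IsPerfectPow q (∏ i, (p i : ℤ) ^ ν j i)) :
    MemT q k ↑(Finset.image (fun j : Fin ℓ => ∏ i, (p i : ℤ) ^ ν j i) Finset.univ) ↔
      MemT q k ↑(Finset.image (fun j : Fin ℓ => ∏ i, (pbar i : ℤ) ^ ν j i) Finset.univ) := by
  have key : ∀ P : Fin n → ℕ,
      MemT q k ↑(Finset.image (fun j : Fin ℓ => ∏ i, (P i : ℤ) ^ ν j i) Finset.univ) ↔
      (∃ Δ : ℕ, 0 < Δ ∧ ∀ N : ℕ, 0 < N → N.primeFactorsList.length ≤ k → Nat.Coprime N Δ →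
        ∃ j, ∃ x : ℤ, (N : ℤ) ∣ x ^ q - ∏ i, (P i : ℤ) ^ ν j i) := by
    intro P
    simp [MemT]
  rw [key, key, sw_main q k hq hn p hp hpinj ν, sw_main q k hq hn pbar hpbar hpbarinj ν]
end
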